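/- Let n ≥ 2. Let f : ℝ^n → ℝ be smooth with Δf + f = 0 on ℝ^n, let K ⊂ ℝ^n be compact, let t ∈ ℕ, and let ε > 0. Then there exist N ∈ ℕ, unit vectors ξ_1, …, ξ_N ∈ S^{n−1}, and real constants α_1, …, α_N, β_1, …, β_N, such that the trigonometric polynomial h(x) = Σ_{j=1}^N ( α_j cos⟨x, ξ_j⟩ + β_j sin⟨x, ξ_j⟩ ) satisfies ‖f − h‖_{C^t(K)} < ε. -/

import Mathlib

open MeasureTheory Real
open scoped RealInnerProductSpace

noncomputable section

/-- The Euclidean Laplacian `Δf = Σᵢ ∂²f/∂xᵢ²` of a function on `ℝ^n`. -/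
def laplacian {n : ℕ} (f : EuclideanSpace ℝ (Fin n) → ℝ) (x : EuclideanSpace ℝ (Fin n)) : ℝ :=
  ∑ i : Fin n,
    fderiv ℝ (fun y => fderiv ℝ f y (EuclideanSpace.single i 1)) x (EuclideanSpace.single i 1)

/-- Euclidean space `ℝ^n`. -/
abbrev Euc (n : ℕ) : Type := EuclideanSpace ℝ (Fin n)

/-- Partial derivative in the `i`-th coordinate direction. -/
def pd {n : ℕ} (i : Fin n) (g : Euc n → ℝ) (x : Euc n) : ℝ :=
  fderiv ℝ g x (EuclideanSpace.single i 1)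

/-- Smooth solutions of the Helmholtz equation `Δg + g = 0`. -/
structure Helmholtz {n : ℕ} (g : Euc n → ℝ) : Prop where
  smooth : ContDiff ℝ (⊤ : ℕ∞) g
  eq : ∀ x, ∑ i, pd i (pd i g) x + g x = 0

section PartialDerivatives

variable {n : ℕ} {g h : Euc n → ℝ}

lemma ContDiff.pd (hg : ContDiff ℝ (⊤ : ℕ∞) g) (i : Fin n) :
    ContDiff ℝ (⊤ : ℕ∞) (pd i g) := by
  have := (contDiff_infty_iff_fderiv.1 hg).2
  exact this.clm_apply contDiff_const

lemma pd_comm (hg : ContDiff ℝ (⊤ : ℕ∞) g) (i j : Fin n) : pd i (pd j g) = pd j (pd i g) := by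
  funext x
  have h1 : ContDiff ℝ (⊤ : ℕ∞) (fderiv ℝ g) := (contDiff_infty_iff_fderiv.1 hg).2
  have h2 : ∀ v w : Euc n, fderiv ℝ (fun y => fderiv ℝ g y v) x w = fderiv ℝ (fderiv ℝ g) x w v := by
    intro v w
    rw [fderiv_clm_apply (h1.differentiable (by simp) x) (by fun_prop)]
    simp
  have h3 : IsSymmSndFDerivAt ℝ g x := hg.contDiffAt.isSymmSndFDerivAt (by simp; exact WithTop.coe_le_coe.2 le_top)
  change fderiv ℝ (fun y => fderiv ℝ g y _) x _ = fderiv ℝ (fun y => fderiv ℝ g y _) x _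
  rw [h2, h2]
  exact h3 _ _

lemma pd_add (hg : Differentiable ℝ g) (hh : Differentiable ℝ h) (i : Fin n) :
    pd i (fun x => g x + h x) = fun x => pd i g x + pd i h x := by
  funext x
  simp only [pd]
  rw [fderiv_fun_add (hg x) (hh x)]
  rfl

lemma pd_sub (hg : Differentiable ℝ g) (hh : Differentiable ℝ h) (i : Fin n) :
    pd i (fun x => g x - h x) = fun x => pd i g x - pd i h x := by
  funext x
  simp only [pd]
  rw [fderiv_fun_sub (hg x) (hh x)]
  rfl

lemma pd_mul (hg : Differentiable ℝ g) (hh : Differentiable ℝ h) (i : Fin n) :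
    pd i (fun x => g x * h x) = fun x => g x * pd i h x + pd i g x * h x := by
  funext x
  simp only [pd]
  rw [fderiv_fun_mul (hg x) (hh x)]
  simp
  ring

lemma pd_const_mul (hg : Differentiable ℝ g) (c : ℝ) (i : Fin n) :
    pd i (fun x => c * g x) = fun x => c * pd i g x := by
  funext x
  simp only [pd]
  rw [fderiv_const_mul (hg x)]
  rfl

lemma pd_sum {ι : Type*} (s : Finset ι) {G : ι → Euc n → ℝ}
    (hG : ∀ k ∈ s, Differentiable ℝ (G k)) (i : Fin n) :
    pd i (fun x => ∑ k ∈ s, G k x) = fun x => ∑ k ∈ s, pd i (G k) x := by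
  funext x
  simp only [pd]
  rw [fderiv_fun_sum fun k hk => hG k hk x]
  simp

lemma pd_const (c : ℝ) (i : Fin n) : pd i (fun _ => c) = fun _ => 0 := by
  funext x
  simp [pd]

lemma pd_coord (i j : Fin n) :
    pd i (fun x : Euc n => x j) = fun _ => if i = j then 1 else 0 := by
  funext x
  have : HasFDerivAt (fun x : Euc n => x j) (EuclideanSpace.proj (𝕜 := ℝ) j) x :=
    (EuclideanSpace.proj (𝕜 := ℝ) j).hasFDerivAt
  simp only [pd]
  rw [this.fderiv]
  simp [eq_comm]

lemma fderiv_apply_eq_sum_pd (g : Euc n → ℝ) (y z : Euc n) :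
    fderiv ℝ g y z = ∑ j, z j * pd j g y := by
  conv_lhs => rw [← (EuclideanSpace.basisFun (Fin n) ℝ).sum_repr z]
  simp [pd]

lemma hasDerivAt_comp_line (hg : Differentiable ℝ g) (x z : Euc n) (s : ℝ) :
    HasDerivAt (fun s : ℝ => g (x + s • z)) (∑ j, z j * pd j g (x + s • z)) s := by
  have h1 : HasDerivAt (fun s : ℝ => x + s • z) z s := by
    simpa using ((hasDerivAt_id s).smul_const z).const_add x
  rw [← fderiv_apply_eq_sum_pd]
  exact (hg _).hasFDerivAt.comp_hasDerivAt s h1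

lemma Helmholtz.differentiable (hg : Helmholtz g) : Differentiable ℝ g :=
  hg.smooth.differentiable (by simp)

lemma ContDiff.diff_of_infty (hg : ContDiff ℝ (⊤ : ℕ∞) g) : Differentiable ℝ g :=
  hg.differentiable (by simp)

lemma Helmholtz.pd (hg : Helmholtz g) (j : Fin n) : Helmholtz (pd j g) := by
  refine ⟨hg.smooth.pd j, fun x => ?_⟩
  have h1 : ∀ i, _root_.pd i (_root_.pd i (_root_.pd j g)) x
      = _root_.pd j (_root_.pd i (_root_.pd i g)) x := by
    intro i
    rw [pd_comm hg.smooth i j, pd_comm (hg.smooth.pd i) i j]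
  have h2 : _root_.pd j (fun x => ∑ i, _root_.pd i (_root_.pd i g) x + g x) x = 0 := by
    rw [funext hg.eq, pd_const]
  rw [pd_add (Differentiable.fun_sum fun i _ => ((hg.smooth.pd i).pd i).diff_of_infty)
    hg.differentiable, pd_sum _ fun i _ => ((hg.smooth.pd i).pd i).diff_of_infty] at h2
  simpa only [h1] using h2

lemma Helmholtz.sub (hg : Helmholtz g) (hh : Helmholtz h) : Helmholtz (fun x => g x - h x) := by
  refine ⟨hg.smooth.sub hh.smooth, fun x => ?_⟩
  have : ∀ i, _root_.pd i (_root_.pd i fun x => g x - h x) x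
      = _root_.pd i (_root_.pd i g) x - _root_.pd i (_root_.pd i h) x := by
    intro i
    rw [pd_sub hg.differentiable hh.differentiable,
      pd_sub (hg.smooth.pd i).diff_of_infty (hh.smooth.pd i).diff_of_infty]
  simp only [this, Finset.sum_sub_distrib]
  linarith [hg.eq x, hh.eq x]

lemma Helmholtz.add (hg : Helmholtz g) (hh : Helmholtz h) : Helmholtz (fun x => g x + h x) := by
  refine ⟨hg.smooth.add hh.smooth, fun x => ?_⟩
  have : ∀ i, _root_.pd i (_root_.pd i fun x => g x + h x) x
      = _root_.pd i (_root_.pd i g) x + _root_.pd i (_root_.pd i h) x := by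
    intro i
    rw [pd_add hg.differentiable hh.differentiable,
      pd_add (hg.smooth.pd i).diff_of_infty (hh.smooth.pd i).diff_of_infty]
  simp only [this, Finset.sum_add_distrib]
  linarith [hg.eq x, hh.eq x]

lemma helmholtz_zero : Helmholtz (fun _ : Euc n => 0) := by
  refine ⟨contDiff_const, fun x => ?_⟩
  simp [pd_const]

lemma Helmholtz.sum {ι : Type*} (s : Finset ι) {G : ι → Euc n → ℝ}
    (hG : ∀ k ∈ s, Helmholtz (G k)) : Helmholtz (fun x => ∑ k ∈ s, G k x) := by
  classical
  induction s using Finset.induction_on with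
  | empty => simpa using helmholtz_zero
  | insert a s ha ih =>
    simp only [Finset.sum_insert ha]
    exact (hG a (by simp)).add (ih fun k hk => hG k (by simp [hk]))

end PartialDerivatives

section GradientEstimate

variable {n : ℕ}

/-- A radial bump `ψ` whose gradient is `φ(z) z` with `φ` smooth and of nonzero mean. -/
lemma exists_radial_kernel (n : ℕ) (hn : 0 < n) : ∃ ψ φ : Euc n → ℝ,
    ContDiff ℝ (⊤ : ℕ∞) ψ ∧ ContDiff ℝ (⊤ : ℕ∞) φ ∧
    (∀ z, 1 ≤ ‖z‖ → ψ z = 0) ∧ (∀ z, 1 ≤ ‖z‖ → φ z = 0) ∧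
    (∀ j z, pd j ψ z = z j * φ z) ∧ ∫ z, φ z ≠ 0 := by
  set σ := Real.smoothTransition with hσ
  have hσs : ContDiff ℝ (⊤ : ℕ∞) σ := Real.smoothTransition.contDiff
  have hσ's : ContDiff ℝ (⊤ : ℕ∞) (deriv σ) := (contDiff_infty_iff_deriv.1 hσs).2
  have hq : ContDiff ℝ (⊤ : ℕ∞) (fun z : Euc n => 1 - ‖z‖ ^ 2) :=
    contDiff_const.sub (contDiff_norm_sq ℝ)
  have hmono : Monotone σ := Real.smoothTransition.monotone
  have hσ'0 : ∀ t, t ≤ 0 → deriv σ t = 0 := by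
    intro t ht
    apply IsLocalMin.deriv_eq_zero
    refine Filter.Eventually.of_forall fun y => ?_
    rw [hσ, Real.smoothTransition.zero_of_nonpos ht]
    exact Real.smoothTransition.nonneg y
  let ψ : Euc n → ℝ := fun z => σ (1 - ‖z‖ ^ 2)
  let φ : Euc n → ℝ := fun z => -2 * deriv σ (1 - ‖z‖ ^ 2)
  have hψ : ContDiff ℝ (⊤ : ℕ∞) ψ := hσs.comp hq
  have hφ : ContDiff ℝ (⊤ : ℕ∞) φ := contDiff_const.mul (hσ's.comp hq)
  have hψ0 : ∀ z, 1 ≤ ‖z‖ → ψ z = 0 := fun z hz =>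
    Real.smoothTransition.zero_of_nonpos (by nlinarith)
  have hφ0 : ∀ z, 1 ≤ ‖z‖ → φ z = 0 := fun z hz => by
    simp only [φ]
    rw [hσ'0 _ (by nlinarith)]
    simp
  have hgrad : ∀ j z, pd j ψ z = z j * φ z := by
    intro j z
    have h1 : HasFDerivAt (fun z : Euc n => 1 - ‖z‖ ^ 2) (-(2 • innerSL ℝ z)) z := by
      simpa using ((hasStrictFDerivAt_norm_sq z).hasFDerivAt).const_sub (1 : ℝ)
    have h2 : HasDerivAt σ (deriv σ (1 - ‖z‖ ^ 2)) (1 - ‖z‖ ^ 2) :=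
      (hσs.differentiable (by simp) _).hasDerivAt
    have h3 := h2.comp_hasFDerivAt z h1
    have h4 : fderiv ℝ ψ z = _ := h3.fderiv
    simp only [pd, h4, φ]
    simp [EuclideanSpace.inner_single_right]
    ring
  refine ⟨ψ, φ, hψ, hφ, hψ0, hφ0, hgrad, fun hmass => ?_⟩
  have hcs : HasCompactSupport φ := by
    refine HasCompactSupport.intro (isCompact_closedBall (0 : Euc n) 1) fun z hz => ?_
    apply hφ0
    simp at hz
    exact hz.le
  have hφi : Integrable φ := hφ.continuous.integrable_of_hasCompactSupport hcs
  have hneg : ∫ z, -φ z = 0 := by rw [integral_neg, hmass, neg_zero]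
  have hnn : 0 ≤ fun z => -φ z := by
    intro z
    have : 0 ≤ deriv σ (1 - ‖z‖ ^ 2) := hmono.deriv_nonneg
    simp only [φ, Pi.zero_apply]
    linarith
  have hzero : (fun z => -φ z) = 0 :=
    (Continuous.ae_eq_iff_eq volume hφ.continuous.neg continuous_zero).1
      ((integral_eq_zero_iff_of_nonneg hnn hφi.neg).1 hneg)
  have hφz : ∀ z, φ z = 0 := fun z => by simpa using congrFun hzero z
  have hf : ∀ z, fderiv ℝ ψ z = 0 := by
    intro z
    ext v
    rw [fderiv_apply_eq_sum_pd]
    simp [hgrad, hφz]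
  have hc := is_const_of_fderiv_eq_zero hψ.diff_of_infty hf 0 (EuclideanSpace.single ⟨0, hn⟩ 1)
  rw [hψ0 (EuclideanSpace.single ⟨0, hn⟩ 1) (by simp)] at hc
  simp [ψ, hσ, Real.smoothTransition.one] at hc

lemma integral_mul_pd_eq_neg {u ψ : Euc n → ℝ} (hu : ContDiff ℝ (⊤ : ℕ∞) u)
    (hψ : ContDiff ℝ (⊤ : ℕ∞) ψ) (hc : HasCompactSupport ψ) (j : Fin n) :
    ∫ z, u z * pd j ψ z = - ∫ z, pd j u z * ψ z := by
  have hc' : HasCompactSupport (pd j ψ) := by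
    refine hc.of_isClosed_subset (isClosed_tsupport _) (closure_minimal ?_ (isClosed_tsupport _))
    intro z hz
    apply support_fderiv_subset ℝ
    intro h0
    apply hz
    simp [pd, h0]
  apply integral_mul_fderiv_eq_neg_fderiv_mul_of_integrable
  · exact ((hu.pd j).continuous.mul hψ.continuous).integrable_of_hasCompactSupport hc.mul_left
  · exact (hu.continuous.mul (hψ.pd j).continuous).integrable_of_hasCompactSupport hc'.mul_left
  · exact (hu.continuous.mul hψ.continuous).integrable_of_hasCompactSupport hc.mul_left
  · exact fun x _ => hu.diff_of_infty x
  · exact fun x _ => hψ.diff_of_infty x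

end GradientEstimate

section GradientEstimate

variable {n : ℕ}

lemma hasCompactSupport_of_vanish {φ : Euc n → ℝ} (h : ∀ z, 1 ≤ ‖z‖ → φ z = 0) :
    HasCompactSupport φ := by
  refine HasCompactSupport.intro (isCompact_closedBall (0 : Euc n) 1) fun z hz => h z ?_
  simp at hz
  exact hz.le

lemma pd_vanish {φ : Euc n → ℝ} (h : ∀ z, 1 ≤ ‖z‖ → φ z = 0) (i : Fin n) (z : Euc n)
    (hz : 1 < ‖z‖) : pd i φ z = 0 := by
  have : φ =ᶠ[nhds z] fun _ => 0 := by
    filter_upwards [(isOpen_lt continuous_const continuous_norm).mem_nhds hz] with y hy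
    exact h y (le_of_lt hy)
  simp [pd, this.fderiv_eq]

lemma pd_comp_affine {u : Euc n → ℝ} (hu : Differentiable ℝ u) (x : Euc n) (s : ℝ) (j : Fin n) :
    pd j (fun z => u (x + s • z)) = fun z => s * pd j u (x + s • z) := by
  funext z
  have h1 : HasFDerivAt (fun z : Euc n => x + s • z) (s • ContinuousLinearMap.id ℝ (Euc n)) z := by
    simpa using ((hasFDerivAt_id z).const_smul s).const_add x
  have h2 := (hu (x + s • z)).hasFDerivAt.comp z h1
  have h3 : fderiv ℝ (fun z => u (x + s • z)) z = _ := h2.fderiv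
  simp only [pd, h3]
  simp

lemma contDiff_comp_affine {u : Euc n → ℝ} (hu : ContDiff ℝ (⊤ : ℕ∞) u) (x : Euc n) (s : ℝ) :
    ContDiff ℝ (⊤ : ℕ∞) (fun z => u (x + s • z)) :=
  hu.comp (contDiff_const.add (contDiff_id.const_smul s))

lemma hasDerivAt_integral_dilate {v φ : Euc n → ℝ} (hv : ContDiff ℝ (⊤ : ℕ∞) v)
    (hφ : Continuous φ) (hφ0 : ∀ z, 1 ≤ ‖z‖ → φ z = 0) (x : Euc n) (s : ℝ) :
    HasDerivAt (fun s : ℝ => ∫ z, v (x + s • z) * φ z)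
      (∫ z, (∑ j, z j * pd j v (x + s • z)) * φ z) s := by
  have hcs := hasCompactSupport_of_vanish hφ0
  let F' : ℝ → Euc n → ℝ := fun s z => (∑ j, z j * pd j v (x + s • z)) * φ z
  have hpd : ∀ j, Continuous (pd j v) := fun j => (hv.pd j).continuous
  have hF'c : Continuous (fun p : ℝ × Euc n => F' p.1 p.2) := by
    refine Continuous.mul (continuous_finsetSum _ fun j _ => ?_) (hφ.comp continuous_snd)
    refine Continuous.mul (by fun_prop) ((hpd j).comp (by fun_prop))
  have hcomp : IsCompact (Set.Icc (s - 1) (s + 1) ×ˢ Metric.closedBall (0 : Euc n) 1) :=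
    isCompact_Icc.prod (isCompact_closedBall _ _)
  obtain ⟨B, hB⟩ := hcomp.exists_bound_of_continuousOn hF'c.continuousOn
  refine (hasDerivAt_integral_of_dominated_loc_of_deriv_le (μ := volume)
    (s := Set.Icc (s - 1) (s + 1)) (F' := F')
    (bound := (Metric.closedBall (0 : Euc n) 1).indicator fun _ => B)
    (Icc_mem_nhds (by linarith) (by linarith)) ?_ ?_ ?_ ?_ ?_ ?_).2
  · refine Filter.Eventually.of_forall fun s => Continuous.aestronglyMeasurable ?_
    exact (hv.continuous.comp (by fun_prop)).mul hφ
  · refine Continuous.integrable_of_hasCompactSupport ?_ hcs.mul_left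
    exact (hv.continuous.comp (by fun_prop)).mul hφ
  · exact (hF'c.comp (by fun_prop : Continuous fun z : Euc n => (s, z))).aestronglyMeasurable
  · refine Filter.Eventually.of_forall fun z t ht => ?_
    by_cases hz : z ∈ Metric.closedBall (0 : Euc n) 1
    · rw [Set.indicator_of_mem hz]
      exact hB (t, z) ⟨ht, hz⟩
    · rw [Set.indicator_of_notMem hz]
      simp at hz
      simp [F', hφ0 z hz.le]
  · exact (integrable_indicator_iff measurableSet_closedBall).2
      (integrableOn_const (measure_closedBall_lt_top.ne))
  · exact Filter.Eventually.of_forall fun z t _ =>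
      (hasDerivAt_comp_line hv.diff_of_infty x z t).mul_const (φ z)

lemma abs_integral_mul_le {u k : Euc n → ℝ} {M : ℝ} (hk : Continuous k)
    (hk0 : ∀ z, 1 < ‖z‖ → k z = 0) (hu : ∀ z, ‖z‖ ≤ 1 → |u z| ≤ M) :
    |∫ z, u z * k z| ≤ M * ∫ z, |k z| := by
  have hcs : HasCompactSupport k := by
    refine HasCompactSupport.intro (isCompact_closedBall (0 : Euc n) 1) fun z hz => hk0 z ?_
    simpa using hz
  rw [← integral_const_mul, ← Real.norm_eq_abs]
  refine norm_integral_le_of_norm_le ?_ (Filter.Eventually.of_forall fun z => ?_)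
  · exact ((hk.integrable_of_hasCompactSupport hcs).abs).const_mul M
  · rw [Real.norm_eq_abs, abs_mul]
    rcases le_or_gt ‖z‖ 1 with hz | hz
    · exact mul_le_mul_of_nonneg_right (hu z hz) (abs_nonneg _)
    · simp [hk0 z hz]

/-- Interior gradient estimate for the Helmholtz equation. -/
lemma exists_gradient_bound (n : ℕ) (hn : 0 < n) : ∃ C : ℝ, 1 ≤ C ∧ ∀ g : Euc n → ℝ,
    Helmholtz g → ∀ (x : Euc n) (r M : ℝ), 0 < r → r ≤ 1 →
    (∀ y, ‖y - x‖ ≤ r → |g y| ≤ M) → ∀ i, |pd i g x| ≤ C / r * M := by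
  obtain ⟨ψ, φ, hψ, hφ, hψ0, hφ0, hgrad, hmass⟩ := exists_radial_kernel n hn
  set I := |∫ z, φ z| with hI
  have hIpos : 0 < I := abs_pos.2 hmass
  let A : Fin n → ℝ := fun i => (∫ z, |pd i φ z|) + ∫ z, |pd i ψ z|
  have hA : ∀ i, 0 ≤ A i := fun i => add_nonneg (integral_nonneg fun _ => abs_nonneg _)
    (integral_nonneg fun _ => abs_nonneg _)
  refine ⟨1 + (∑ i, A i) / I, by
    have := Finset.sum_nonneg fun i (_ : i ∈ Finset.univ) => hA i
    have : 0 ≤ (∑ i, A i) / I := by positivity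
    linarith, ?_⟩
  intro g hg x r M hr hr1 hM i
  have hM0 : 0 ≤ M := (abs_nonneg _).trans (hM x (by simpa using hr.le))
  have hv := hg.pd i
  set v := pd i g with hvdef
  have hψc := hasCompactSupport_of_vanish hψ0
  have hφc := hasCompactSupport_of_vanish hφ0
  let N : ℝ → ℝ := fun s => ∫ z, v (x + s • z) * φ z
  have hgx : ∀ s, 0 ≤ s → s ≤ r → ∀ z : Euc n, ‖z‖ ≤ 1 → |g (x + s • z)| ≤ M := by
    intro s hs hsr z hz
    apply hM
    rw [add_sub_cancel_left, norm_smul, Real.norm_of_nonneg hs]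
    nlinarith [norm_nonneg z]
  have hparts : ∀ (s : ℝ) (k : Euc n → ℝ), ContDiff ℝ (⊤ : ℕ∞) k → HasCompactSupport k →
      s * ∫ z, v (x + s • z) * k z = - ∫ z, g (x + s • z) * pd i k z := by
    intro s k hk hkc
    rw [integral_mul_pd_eq_neg (contDiff_comp_affine hg.smooth x s) hk hkc i, neg_neg,
      ← integral_const_mul]
    congr 1
    funext z
    rw [pd_comp_affine hg.differentiable, mul_assoc]
  have hN' : ∀ s, HasDerivAt N (- ∫ z, g (x + s • z) * pd i ψ z) s := by
    intro s
    convert hasDerivAt_integral_dilate hv.smooth hφ.continuous hφ0 x s using 1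
    rw [← hparts s ψ hψ hψc]
    have h1 : ∀ z, (∑ j, z j * pd j v (x + s • z)) * φ z
        = ∑ j, pd j v (x + s • z) * pd j ψ z := by
      intro z
      rw [Finset.sum_mul]
      refine Finset.sum_congr rfl fun j _ => ?_
      rw [hgrad]
      ring
    have hsm : ∀ j, ContDiff ℝ (⊤ : ℕ∞) (fun z => pd j v (x + s • z)) := fun j =>
      contDiff_comp_affine (hv.smooth.pd j) x s
    have h2 : ∀ j, ∫ z, pd j v (x + s • z) * pd j ψ z
        = - ∫ z, s * pd j (pd j v) (x + s • z) * ψ z := by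
      intro j
      rw [integral_mul_pd_eq_neg (hsm j) hψ hψc j]
      simp only [pd_comp_affine (hv.smooth.pd j).diff_of_infty]
    have hpdψ : ∀ j, HasCompactSupport (pd j ψ) := by
      intro j
      apply hasCompactSupport_of_vanish
      intro z hz
      rw [hgrad, hφ0 z hz, mul_zero]
    have hsm2 : ∀ j, ContDiff ℝ (⊤ : ℕ∞) (fun z => pd j (pd j v) (x + s • z)) := fun j =>
      contDiff_comp_affine ((hv.smooth.pd j).pd j) x s
    simp only [h1]
    rw [integral_finsetSum]
    · simp only [h2]
      rw [Finset.sum_neg_distrib, ← integral_finsetSum, ← integral_neg, ← integral_const_mul]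
      · congr 1
        funext z
        rw [← Finset.sum_mul, ← Finset.mul_sum]
        linear_combination (s * ψ z) * hv.eq (x + s • z)
      · intro j _
        exact ((contDiff_const.mul (hsm2 j)).continuous.mul
          hψ.continuous).integrable_of_hasCompactSupport hψc.mul_left
    · intro j _
      exact ((hsm j).continuous.mul
        (hψ.pd j).continuous).integrable_of_hasCompactSupport (hpdψ j).mul_left
  have hN0 : N 0 = v x * ∫ z, φ z := by
    simp only [N, zero_smul, add_zero]
    rw [integral_const_mul]
  have hNr : |N r| ≤ M / r * ∫ z, |pd i φ z| := by
    have h1 := hparts r φ hφ hφc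
    have h2 : N r = - (∫ z, g (x + r • z) * pd i φ z) / r := by
      rw [← h1]
      simp only [N]
      field_simp
    have h3 := abs_integral_mul_le (M := M) (hφ.pd i).continuous (pd_vanish hφ0 i)
      (hgx r hr.le le_rfl)
    rw [h2, abs_div, abs_neg, abs_of_pos hr, div_mul_eq_mul_div]
    exact div_le_div_of_nonneg_right h3 hr.le
  have hdiff : |N r - N 0| ≤ (M * ∫ z, |pd i ψ z|) * (r - 0) := by
    have := norm_image_sub_le_of_norm_deriv_le_segment' (f := N) (a := 0) (b := r)
      (C := M * ∫ z, |pd i ψ z|) (fun s _ => (hN' s).hasDerivWithinAt) (by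
        intro s hs
        rw [norm_neg, Real.norm_eq_abs]
        exact abs_integral_mul_le (hψ.pd i).continuous (pd_vanish hψ0 i)
          (hgx s hs.1 hs.2.le)) r ⟨hr.le, le_rfl⟩
    simpa using this
  have hmain : |v x| * I ≤ A i * (M / r) := by
    rw [hI, ← abs_mul, ← hN0]
    have h1 : |N 0| ≤ |N r| + |N r - N 0| := by
      have := abs_sub_abs_le_abs_sub (N 0) (N r)
      rw [abs_sub_comm] at this
      linarith
    have h2 : M * r ≤ M / r := by
      rw [le_div_iff₀ hr]
      have : r * r ≤ 1 := by nlinarith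
      nlinarith
    have h3 : 0 ≤ ∫ z, |pd i ψ z| := integral_nonneg fun _ => abs_nonneg _
    have h4 := mul_le_mul_of_nonneg_left h2 h3
    simp only [A]
    nlinarith
  have hle : A i ≤ ∑ i, A i := Finset.single_le_sum (fun i _ => hA i) (Finset.mem_univ i)
  have h5 : |v x| ≤ A i * (M / r) / I := by rwa [le_div_iff₀ hIpos]
  have hMr : 0 ≤ M / r := by positivity
  calc |v x| ≤ A i * (M / r) / I := h5
    _ = A i / I * (M / r) := by ring
    _ ≤ (1 + (∑ i, A i) / I) * (M / r) := by
        refine mul_le_mul_of_nonneg_right ?_ hMr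
        have := div_le_div_of_nonneg_right hle hIpos.le
        linarith
    _ = _ := by ring

end GradientEstimate

section Words

variable {n : ℕ}

/-- Iterated partial derivatives along a word of coordinate indices. -/
def wordDeriv (w : List (Fin n)) (g : Euc n → ℝ) : Euc n → ℝ := w.foldr (fun i u => pd i u) g

@[simp] lemma wordDeriv_nil (g : Euc n → ℝ) : wordDeriv [] g = g := rfl

@[simp] lemma wordDeriv_cons (i : Fin n) (w : List (Fin n)) (g : Euc n → ℝ) :
    wordDeriv (i :: w) g = pd i (wordDeriv w g) := rfl

lemma wordDeriv_append (v w : List (Fin n)) (g : Euc n → ℝ) :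
    wordDeriv (v ++ w) g = wordDeriv v (wordDeriv w g) := by
  simp [wordDeriv]

lemma ContDiff.wordDeriv {g : Euc n → ℝ} (hg : ContDiff ℝ (⊤ : ℕ∞) g) (w : List (Fin n)) :
    ContDiff ℝ (⊤ : ℕ∞) (wordDeriv w g) := by
  induction w with
  | nil => exact hg
  | cons i w ih => exact ih.pd i

lemma Helmholtz.wordDeriv {g : Euc n → ℝ} (hg : Helmholtz g) (w : List (Fin n)) :
    Helmholtz (wordDeriv w g) := by
  induction w with
  | nil => exact hg
  | cons i w ih => exact ih.pd i

lemma wordDeriv_perm {g : Euc n → ℝ} (hg : ContDiff ℝ (⊤ : ℕ∞) g) {v w : List (Fin n)}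
    (h : v.Perm w) : wordDeriv v g = wordDeriv w g := by
  induction h with
  | nil => rfl
  | cons i _ ih => simp [ih]
  | swap i j l => exact pd_comm (hg.wordDeriv l) _ _
  | trans _ _ ih1 ih2 => exact ih1.trans ih2

lemma wordDeriv_sub {g h : Euc n → ℝ} (hg : ContDiff ℝ (⊤ : ℕ∞) g) (hh : ContDiff ℝ (⊤ : ℕ∞) h)
    (w : List (Fin n)) :
    wordDeriv w (fun x => g x - h x) = fun x => wordDeriv w g x - wordDeriv w h x := by
  induction w with
  | nil => rfl
  | cons i w ih =>
    simp only [wordDeriv_cons, ih]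
    exact pd_sub (hg.wordDeriv w).diff_of_infty (hh.wordDeriv w).diff_of_infty i

lemma wordDeriv_add {g h : Euc n → ℝ} (hg : ContDiff ℝ (⊤ : ℕ∞) g) (hh : ContDiff ℝ (⊤ : ℕ∞) h)
    (w : List (Fin n)) :
    wordDeriv w (fun x => g x + h x) = fun x => wordDeriv w g x + wordDeriv w h x := by
  induction w with
  | nil => rfl
  | cons i w ih =>
    simp only [wordDeriv_cons, ih]
    exact pd_add (hg.wordDeriv w).diff_of_infty (hh.wordDeriv w).diff_of_infty i

lemma wordDeriv_sum {ι : Type*} (s : Finset ι) {G : ι → Euc n → ℝ}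
    (hG : ∀ k ∈ s, ContDiff ℝ (⊤ : ℕ∞) (G k)) (w : List (Fin n)) :
    wordDeriv w (fun x => ∑ k ∈ s, G k x) = fun x => ∑ k ∈ s, wordDeriv w (G k) x := by
  induction w with
  | nil => rfl
  | cons i w ih =>
    simp only [wordDeriv_cons, ih]
    exact pd_sum s (fun k hk => ((hG k hk).wordDeriv w).diff_of_infty) i

/-- The interior gradient estimate with constant `C`. -/
def GradientBound (n : ℕ) (C : ℝ) : Prop := ∀ g : Euc n → ℝ,
    Helmholtz g → ∀ (x : Euc n) (r M : ℝ), 0 < r → r ≤ 1 →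
    (∀ y, ‖y - x‖ ≤ r → |g y| ≤ M) → ∀ i, |pd i g x| ≤ C / r * M

lemma abs_wordDeriv_le {C : ℝ} (hC : GradientBound n C) {g : Euc n → ℝ} (hg : Helmholtz g)
    {r M : ℝ} (hr : 0 < r) (hr1 : r ≤ 1) (w : List (Fin n)) :
    ∀ x : Euc n, (∀ y, ‖y - x‖ ≤ w.length * r → |g y| ≤ M) →
      |wordDeriv w g x| ≤ (C / r) ^ w.length * M := by
  induction w with
  | nil =>
    intro x h
    simpa using h x (by simp)
  | cons i w ih =>
    intro x h
    rw [wordDeriv_cons, List.length_cons, pow_succ', mul_assoc]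
    refine hC _ (hg.wordDeriv w) x r _ hr hr1 (fun y hy => ih y fun z hz => h z ?_) i
    calc ‖z - x‖ ≤ ‖z - y‖ + ‖y - x‖ := norm_sub_le_norm_sub_add_norm_sub z y x
      _ ≤ w.length * r + r := add_le_add hz hy
      _ = _ := by push_cast [List.length_cons]; ring

lemma norm_iteratedFDeriv_succ_le {g : Euc n → ℝ} (hg : ContDiff ℝ (⊤ : ℕ∞) g) (m : ℕ)
    (x : Euc n) :
    ‖iteratedFDeriv ℝ (m + 1) g x‖ ≤ ∑ i, ‖iteratedFDeriv ℝ m (pd i g) x‖ := by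
  rw [← norm_iteratedFDeriv_fderiv]
  let L : Fin n → (ℝ →L[ℝ] (Euc n →L[ℝ] ℝ)) := fun i =>
    ContinuousLinearMap.toSpanSingleton ℝ (EuclideanSpace.proj (𝕜 := ℝ) i)
  have hL : ∀ i, ‖L i‖ ≤ 1 := by
    intro i
    rw [ContinuousLinearMap.norm_toSpanSingleton]
    refine ContinuousLinearMap.opNorm_le_bound _ zero_le_one fun y => ?_
    simpa using PiLp.norm_apply_le y i
  have hfd : fderiv ℝ g = fun y => ∑ i, (L i ∘ pd i g) y := by
    funext y
    ext z
    rw [fderiv_apply_eq_sum_pd]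
    simp [L, mul_comm]
  have hsm : ∀ i, ContDiff ℝ (⊤ : ℕ∞) (L i ∘ pd i g) := fun i => (L i).contDiff.comp (hg.pd i)
  have hm : ((m : ℕ∞) : WithTop ℕ∞) ≤ ((⊤ : ℕ∞) : WithTop ℕ∞) := WithTop.coe_le_coe.2 le_top
  have hsum : iteratedFDeriv ℝ m (fun y => ∑ i, (L i ∘ pd i g) y) x
      = ∑ i, iteratedFDeriv ℝ m (L i ∘ pd i g) x :=
    iteratedFDeriv_fun_sum_apply fun i _ => ((hsm i).of_le hm).contDiffAt
  rw [hfd, hsum]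
  refine (norm_sum_le _ _).trans (Finset.sum_le_sum fun i _ => ?_)
  refine ((L i).norm_iteratedFDeriv_comp_left (hg.pd i).contDiffAt hm).trans ?_
  exact mul_le_of_le_one_left (norm_nonneg _) (hL i)

lemma norm_iteratedFDeriv_le_of_helmholtz {C : ℝ} (hC : GradientBound n C) (m : ℕ) :
    ∀ (g : Euc n → ℝ) (_ : Helmholtz g) (x : Euc n) (M : ℝ),
      (∀ y, ‖y - x‖ ≤ m → |g y| ≤ M) → ‖iteratedFDeriv ℝ m g x‖ ≤ (n * C) ^ m * M := by
  induction m with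
  | zero =>
    intro g _ x M h
    simpa using h x (by simp)
  | succ m ih =>
    intro g hg x M h
    refine (norm_iteratedFDeriv_succ_le hg.smooth m x).trans ?_
    have h1 : ∀ i, ‖iteratedFDeriv ℝ m (pd i g) x‖ ≤ (n * C) ^ m * (C * M) := by
      intro i
      refine ih _ (hg.pd i) x _ fun y hy => ?_
      have := hC g hg y 1 M one_pos le_rfl (fun z hz => h z ?_) i
      · simpa using this
      · calc ‖z - x‖ ≤ ‖z - y‖ + ‖y - x‖ := norm_sub_le_norm_sub_add_norm_sub z y x
          _ ≤ 1 + m := add_le_add hz hy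
          _ = _ := by push_cast; ring
    refine (Finset.sum_le_sum fun i _ => h1 i).trans (le_of_eq ?_)
    simp
    ring

/-- Integration of a power bound on the derivative over `[0, 1]`. -/
lemma abs_le_of_abs_deriv_le_pow {φ φ' : ℝ → ℝ} (hφ : ∀ t, HasDerivAt φ (φ' t) t) (h0 : φ 0 = 0)
    {B c : ℝ} {j : ℕ}
    (hb : ∀ t, 0 ≤ t → t ≤ 1 → |φ' t| ≤ B * (c ^ (j + 1) * t ^ j / j.factorial)) :
    |φ 1| ≤ B * (c ^ (j + 1) / (j + 1).factorial) := by
  have hBd : ∀ t : ℝ, HasDerivAt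
      (fun t : ℝ => B * (c ^ (j + 1) * t ^ (j + 1) / (j + 1).factorial))
      (B * (c ^ (j + 1) * t ^ j / j.factorial)) t := by
    intro t
    have h1 := (((hasDerivAt_pow (j + 1) t).const_mul (c ^ (j + 1))).div_const
      ((j + 1).factorial : ℝ)).const_mul B
    refine h1.congr_deriv ?_
    rw [Nat.factorial_succ]
    have : (j.factorial : ℝ) ≠ 0 := by positivity
    push_cast
    field_simp
  have hfence := image_norm_le_of_norm_deriv_right_le_deriv_boundary (a := (0 : ℝ)) (b := 1)
    (fun t _ => (hφ t).continuousAt.continuousWithinAt)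
    (fun t _ => (hφ t).hasDerivWithinAt) (by simp [h0]) hBd
    (fun t ht => hb t ht.1 ht.2.le) (x := 1) ⟨zero_le_one, le_rfl⟩
  simpa using hfence

/-- Taylor estimate at the origin for a function whose jet of order `m` vanishes there. -/
lemma abs_le_of_vanishing_jet {g : Euc n → ℝ} (hg : ContDiff ℝ (⊤ : ℕ∞) g) {m : ℕ} {B R : ℝ}
    (h0 : ∀ w : List (Fin n), w.length ≤ m → wordDeriv w g 0 = 0)
    (hB : ∀ w : List (Fin n), w.length = m + 1 → ∀ x, ‖x‖ ≤ R → |wordDeriv w g x| ≤ B)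
    {x : Euc n} (hx : ‖x‖ ≤ R) :
    |g x| ≤ B * ((n * ‖x‖) ^ (m + 1) / (m + 1).factorial) := by
  suffices H : ∀ (j : ℕ) (w : List (Fin n)), w.length + j = m + 1 → ∀ x, ‖x‖ ≤ R →
      |wordDeriv w g x| ≤ B * ((n * ‖x‖) ^ j / j.factorial) by
    simpa using H (m + 1) [] (by simp) x hx
  intro j
  induction j with
  | zero =>
    intro w hw x hx
    simpa using hB w (by omega) x hx
  | succ j ih =>
    intro w hw x hx
    have hu := hg.wordDeriv w
    set u := wordDeriv w g
    have hu0 : u 0 = 0 := h0 w (by omega)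
    have := abs_le_of_abs_deriv_le_pow (B := B) (c := n * ‖x‖) (j := j)
      (fun t => hasDerivAt_comp_line hu.diff_of_infty 0 x t) (by simpa using hu0) (by
        intro t ht0 ht1
        rw [zero_add]
        have htx : ‖t • x‖ = t * ‖x‖ := by rw [norm_smul, Real.norm_of_nonneg ht0]
        have hle : ‖t • x‖ ≤ R := by
          rw [htx]
          nlinarith [norm_nonneg x]
        have h1 : ∀ i, |x i * pd i u (t • x)|
            ≤ ‖x‖ * (B * ((n * (t * ‖x‖)) ^ j / j.factorial)) := by
          intro i
          rw [abs_mul]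
          refine mul_le_mul (PiLp.norm_apply_le x i) ?_ (abs_nonneg _) (norm_nonneg _)
          have := ih (i :: w) (by simp; omega) (t • x) hle
          rwa [htx] at this
        refine (Finset.abs_sum_le_sum_abs _ _).trans
          ((Finset.sum_le_sum fun i _ => h1 i).trans (le_of_eq ?_))
        simp
        ring)
    simpa using this

end Words

section CauchySolutions

/-- The coefficients in the expansions
`cos (s √(1 + v)) = ∑ j, cosCoeff j s * v ^ j` and
`sin (s √(1 + v)) / √(1 + v) = ∑ j, sinCoeff j s * v ^ j`. -/
def trigCoeff : ℕ → (ℝ → ℝ) × (ℝ → ℝ)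
  | 0 => (Real.cos, Real.sin)
  | j + 1 => (fun s => -(s * (trigCoeff j).2 s) / (2 * (j + 1)),
      fun s => (s * (trigCoeff j).1 s - (2 * j + 1) * (trigCoeff j).2 s) / (2 * (j + 1)))

/-- Taylor coefficients of `v ↦ cos (s √(1 + v))`. -/
def cosCoeff (j : ℕ) : ℝ → ℝ := (trigCoeff j).1

/-- Taylor coefficients of `v ↦ sin (s √(1 + v)) / √(1 + v)`. -/
def sinCoeff (j : ℕ) : ℝ → ℝ := (trigCoeff j).2

/-- The coefficient `sinCoeff (j - 1)`, with value `0` for `j = 0`. -/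
def sinCoeffPred : ℕ → ℝ → ℝ
  | 0 => fun _ => 0
  | j + 1 => sinCoeff j

lemma cosCoeff_succ (j : ℕ) (s : ℝ) :
    2 * ((j : ℝ) + 1) * cosCoeff (j + 1) s = -(s * sinCoeff j s) := by
  have : (2 * ((j : ℝ) + 1)) ≠ 0 := by positivity
  simp only [cosCoeff, sinCoeff, trigCoeff]
  field_simp

lemma sinCoeff_succ (j : ℕ) (s : ℝ) :
    2 * ((j : ℝ) + 1) * sinCoeff (j + 1) s = s * cosCoeff j s - (2 * j + 1) * sinCoeff j s := by
  have : (2 * ((j : ℝ) + 1)) ≠ 0 := by positivity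
  simp only [cosCoeff, sinCoeff, trigCoeff]
  field_simp

lemma hasDerivAt_trigCoeff (j : ℕ) : ∀ s,
    HasDerivAt (sinCoeff j) (cosCoeff j s) s ∧
    HasDerivAt (cosCoeff j) (-sinCoeff j s - sinCoeffPred j s) s := by
  induction j with
  | zero =>
    intro s
    refine ⟨Real.hasDerivAt_sin s, ?_⟩
    exact (Real.hasDerivAt_cos s).congr_deriv (by simp [sinCoeff, trigCoeff, sinCoeffPred])
  | succ j ih =>
    intro s
    obtain ⟨hD, hC⟩ := ih s
    have hj : (2 * ((j : ℝ) + 1)) ≠ 0 := by positivity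
    have key : s * (-sinCoeff j s - sinCoeffPred j s) = 2 * j * cosCoeff j s - s * sinCoeff j s := by
      cases j with
      | zero => simp [sinCoeffPred]
      | succ i =>
        have := cosCoeff_succ i s
        simp only [sinCoeffPred]
        push_cast
        linarith
    constructor
    · have h := (((hasDerivAt_id s).mul hC).sub (hD.const_mul (2 * (j : ℝ) + 1))).div_const
        (2 * ((j : ℝ) + 1))
      refine h.congr_deriv ?_
      rw [div_eq_iff hj, mul_comm (cosCoeff (j + 1) s), cosCoeff_succ]
      simp only [id]
      linear_combination key
    · have h := (((hasDerivAt_id s).mul hD).neg).div_const (2 * ((j : ℝ) + 1))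
      refine h.congr_deriv ?_
      rw [div_eq_iff hj]
      simp only [id, sinCoeffPred]
      linear_combination sinCoeff_succ j s

lemma deriv_sinCoeff (j : ℕ) : deriv (sinCoeff j) = cosCoeff j :=
  funext fun s => (hasDerivAt_trigCoeff j s).1.deriv

lemma deriv_cosCoeff (j : ℕ) : deriv (cosCoeff j) = fun s => -sinCoeff j s - sinCoeffPred j s :=
  funext fun s => (hasDerivAt_trigCoeff j s).2.deriv

lemma trigCoeff_zero (j : ℕ) : sinCoeff j 0 = 0 ∧ cosCoeff (j + 1) 0 = 0 := by
  have h1 : sinCoeff j 0 = 0 := by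
    induction j with
    | zero => simp [sinCoeff, trigCoeff]
    | succ j ih =>
      have h := sinCoeff_succ j 0
      rw [ih] at h
      have : (2 * ((j : ℝ) + 1)) ≠ 0 := by positivity
      simpa [this] using h
  refine ⟨h1, ?_⟩
  have h := cosCoeff_succ j 0
  have : (2 * ((j : ℝ) + 1)) ≠ 0 := by positivity
  simpa [this] using h

lemma contDiff_trigCoeff (j : ℕ) :
    ContDiff ℝ (⊤ : ℕ∞) (cosCoeff j) ∧ ContDiff ℝ (⊤ : ℕ∞) (sinCoeff j) := by
  induction j with
  | zero => exact ⟨Real.contDiff_cos, Real.contDiff_sin⟩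
  | succ j ih =>
    constructor
    · exact ((contDiff_id.mul ih.2).neg).div_const _
    · exact ((contDiff_id.mul ih.1).sub (contDiff_const.mul ih.2)).div_const _

lemma abs_trigCoeff_le (j : ℕ) : ∀ s,
    |cosCoeff j s| ≤ |s| ^ (2 * j) / (2 * j).factorial ∧
    |sinCoeff j s| ≤ |s| ^ (2 * j + 1) / (2 * j + 1).factorial := by
  have hstep : ∀ j, (∀ s, |cosCoeff j s| ≤ |s| ^ (2 * j) / (2 * j).factorial) →
      ∀ s, |sinCoeff j s| ≤ |s| ^ (2 * j + 1) / (2 * j + 1).factorial := by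
    intro j h s
    have hd : ∀ t, HasDerivAt (fun t => sinCoeff j (t * s)) (cosCoeff j (t * s) * s) t := by
      intro t
      have := (hasDerivAt_trigCoeff j (t * s)).1.comp t ((hasDerivAt_id t).mul_const s)
      exact this.congr_deriv (by simp)
    have := abs_le_of_abs_deriv_le_pow (B := 1) (c := |s|) (j := 2 * j) hd
      (by simpa using (trigCoeff_zero j).1) (by
        intro t ht _
        rw [abs_mul, one_mul]
        calc |cosCoeff j (t * s)| * |s| ≤ |t * s| ^ (2 * j) / (2 * j).factorial * |s| :=
              mul_le_mul_of_nonneg_right (h _) (abs_nonneg _)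
          _ = _ := by rw [abs_mul, abs_of_nonneg ht]; ring)
    simpa using this
  induction j with
  | zero =>
    have h0 : ∀ s, |cosCoeff 0 s| ≤ |s| ^ (2 * 0) / (2 * 0).factorial := by
      intro s
      simpa [cosCoeff, trigCoeff] using Real.abs_cos_le_one s
    exact fun s => ⟨h0 s, hstep 0 h0 s⟩
  | succ j ih =>
    have h0 : ∀ s, |cosCoeff (j + 1) s| ≤ |s| ^ (2 * (j + 1)) / (2 * (j + 1)).factorial := by
      intro s
      have hj : 0 < 2 * ((j : ℝ) + 1) := by positivity
      have h1 : cosCoeff (j + 1) s = -(s * sinCoeff j s) / (2 * ((j : ℝ) + 1)) := by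
        rw [eq_div_iff hj.ne', mul_comm, cosCoeff_succ]
      rw [h1, abs_div, abs_neg, abs_mul, abs_of_pos hj, div_le_iff₀ hj]
      refine (mul_le_mul_of_nonneg_left (ih s).2 (abs_nonneg s)).trans (le_of_eq ?_)
      have : 2 * (j + 1) = (2 * j + 1) + 1 := by ring
      rw [this, Nat.factorial_succ (2 * j + 1)]
      have : ((2 * j + 1).factorial : ℝ) ≠ 0 := by positivity
      push_cast
      field_simp
      ring
    exact fun s => ⟨h0 s, hstep (j + 1) h0 s⟩

variable {d : ℕ}

/-- Dropping a first letter from the words indexing a family of coefficients. -/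
def shift (i : Fin d) (a : List (Fin d) → ℝ) : List (Fin d) → ℝ := fun w => a (i :: w)

/-- The Laplacian on families of Taylor coefficients indexed by words. -/
def wordLap (a : List (Fin d) → ℝ) : List (Fin d) → ℝ := fun w => ∑ l, a (l :: l :: w)

/-- Families indexed by words that only depend on the letters up to order. -/
def PermInvariant (a : List (Fin d) → ℝ) : Prop := ∀ ⦃v w : List (Fin d)⦄, v.Perm w → a v = a w

lemma PermInvariant.shift {a : List (Fin d) → ℝ} (ha : PermInvariant a) (i : Fin d) :
    PermInvariant (shift i a) := fun _ _ h => ha (h.cons i)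

lemma PermInvariant.wordLap {a : List (Fin d) → ℝ} (ha : PermInvariant a) :
    PermInvariant (wordLap a) :=
  fun _ _ h => Finset.sum_congr rfl fun l _ => ha ((h.cons l).cons l)

lemma PermInvariant.shift_shift {a : List (Fin d) → ℝ} (ha : PermInvariant a) (i l : Fin d) :
    _root_.shift l (_root_.shift i a) = _root_.shift i (_root_.shift l a) :=
  funext fun w => ha (List.Perm.swap l i w)

lemma PermInvariant.wordLap_shift {a : List (Fin d) → ℝ} (ha : PermInvariant a) (i : Fin d) :
    _root_.wordLap (_root_.shift i a) = _root_.shift i (_root_.wordLap a) := by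
  funext w
  refine Finset.sum_congr rfl fun l _ => ha ?_
  exact (List.Perm.swap l i (l :: w)).trans ((List.Perm.swap l i w).cons l)

/-- The homogeneous polynomial of degree `k` in the variables `x 1, …, x d` whose derivatives of
order `k` are given by `a`. -/
def taylorPart : ℕ → (List (Fin d) → ℝ) → Euc (d + 1) → ℝ
  | 0, a, _ => a []
  | k + 1, a, x => (∑ i, x i.succ * taylorPart k (shift i a) x) / (k + 1)

/-- The sum `∑ i, F (j + i) (x 0) * Δⁱ q x` where `q = taylorPart k a`. For `j = 0` and
`F = cosCoeff` or `F = sinCoeff` this is the Helmholtz solution with Cauchy data `(q, 0)` or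
`(0, q)` on the hyperplane `x 0 = 0`. -/
def cauchySol (F : ℕ → ℝ → ℝ) : ℕ → ℕ → (List (Fin d) → ℝ) → Euc (d + 1) → ℝ
  | j, 0, a, x => F j (x 0) * taylorPart 0 a x
  | j, 1, a, x => F j (x 0) * taylorPart 1 a x
  | j, k + 2, a, x => F j (x 0) * taylorPart (k + 2) a x + cauchySol F (j + 1) k (wordLap a) x

lemma sum_mul_taylorPart (k : ℕ) (a : List (Fin d) → ℝ) (x : Euc (d + 1)) :
    ∑ i, x i.succ * taylorPart k (shift i a) x = (k + 1) * taylorPart (k + 1) a x := by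
  have : (k : ℝ) + 1 ≠ 0 := by positivity
  simp only [taylorPart]
  field_simp

lemma contDiff_coord (i : Fin (d + 1)) : ContDiff ℝ (⊤ : ℕ∞) (fun x : Euc (d + 1) => x i) :=
  (EuclideanSpace.proj (𝕜 := ℝ) i).contDiff

lemma contDiff_taylorPart (k : ℕ) : ∀ a : List (Fin d) → ℝ,
    ContDiff ℝ (⊤ : ℕ∞) (taylorPart k a) := by
  induction k with
  | zero => exact fun a => contDiff_const
  | succ k ih =>
    intro a
    exact (ContDiff.sum fun i _ => (contDiff_coord i.succ).mul (ih _)).div_const _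

lemma taylorPart_sum (k : ℕ) : ∀ (b : Fin d → List (Fin d) → ℝ) (x : Euc (d + 1)),
    taylorPart k (fun w => ∑ l, b l w) x = ∑ l, taylorPart k (b l) x := by
  induction k with
  | zero => exact fun b x => rfl
  | succ k ih =>
    intro b x
    simp only [taylorPart]
    rw [← Finset.sum_div, Finset.sum_comm]
    congr 1
    refine Finset.sum_congr rfl fun i _ => ?_
    rw [← Finset.mul_sum, ← ih]
    rfl

lemma cauchySol_sum (F : ℕ → ℝ → ℝ) (j k : ℕ) : ∀ (b : Fin d → List (Fin d) → ℝ)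
    (x : Euc (d + 1)),
    cauchySol F j k (fun w => ∑ l, b l w) x = ∑ l, cauchySol F j k (b l) x := by
  induction k using Nat.twoStepInduction generalizing j with
  | zero => exact fun b x => by simp only [cauchySol, taylorPart_sum, Finset.mul_sum]
  | one => exact fun b x => by simp only [cauchySol, taylorPart_sum, Finset.mul_sum]
  | more k ih _ =>
    intro b x
    simp only [cauchySol]
    rw [Finset.sum_add_distrib, ← ih, taylorPart_sum, Finset.mul_sum]
    congr 2
    funext w
    exact Finset.sum_comm

lemma sum_cauchySol_shift_shift (F : ℕ → ℝ → ℝ) (j k : ℕ) (a : List (Fin d) → ℝ)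
    (x : Euc (d + 1)) :
    ∑ l, cauchySol F j k (shift l (shift l a)) x = cauchySol F j k (wordLap a) x :=
  (cauchySol_sum F j k (fun l => shift l (shift l a)) x).symm

lemma pd_zero_taylorPart (k : ℕ) : ∀ a : List (Fin d) → ℝ, pd 0 (taylorPart k a) = fun _ => 0 := by
  induction k with
  | zero => exact fun a => pd_const _ _
  | succ k ih =>
    intro a
    have hsm : ∀ i : Fin d, Differentiable ℝ (taylorPart k (shift i a)) := fun i =>
      (contDiff_taylorPart k _).diff_of_infty
    have hc : ∀ i : Fin d, Differentiable ℝ (fun x : Euc (d + 1) => x i.succ) := fun i =>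
      (contDiff_coord i.succ).diff_of_infty
    have h1 : taylorPart (k + 1) a
        = fun x => ((k : ℝ) + 1)⁻¹ * ∑ i, x i.succ * taylorPart k (shift i a) x := by
      funext x
      simp only [taylorPart]
      ring
    rw [h1, pd_const_mul (Differentiable.fun_sum fun i _ => (hc i).fun_mul (hsm i)),
      pd_sum _ fun i _ => (hc i).fun_mul (hsm i)]
    funext x
    simp [pd_mul (hc _) (hsm _), ih, pd_coord, (Fin.succ_ne_zero _).symm]

lemma pd_succ_taylorPart (k : ℕ) : ∀ {a : List (Fin d) → ℝ}, PermInvariant a → ∀ l : Fin d,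
    pd l.succ (taylorPart (k + 1) a) = taylorPart k (shift l a) := by
  induction k with
  | zero =>
    intro a _ l
    have h1 : taylorPart 1 a = fun x => ∑ i, shift i a [] * x i.succ := by
      funext x
      simp [taylorPart, mul_comm]
    have hc : ∀ i : Fin d, Differentiable ℝ (fun x : Euc (d + 1) => x i.succ) := fun i =>
      (contDiff_coord i.succ).diff_of_infty
    rw [h1, pd_sum _ fun i _ => (hc i).const_mul _]
    funext x
    simp [pd_const_mul (hc _), pd_coord, taylorPart]
  | succ k ih =>
    intro a ha l
    have hsm : ∀ i : Fin d, Differentiable ℝ (taylorPart (k + 1) (shift i a)) := fun i =>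
      (contDiff_taylorPart _ _).diff_of_infty
    have hc : ∀ i : Fin d, Differentiable ℝ (fun x : Euc (d + 1) => x i.succ) := fun i =>
      (contDiff_coord i.succ).diff_of_infty
    have h1 : taylorPart (k + 1 + 1) a
        = fun x => ((k : ℝ) + 2)⁻¹ * ∑ i, x i.succ * taylorPart (k + 1) (shift i a) x := by
      funext x
      rw [sum_mul_taylorPart]
      have : (k : ℝ) + 2 ≠ 0 := by positivity
      push_cast
      field_simp
      ring
    rw [h1, pd_const_mul (Differentiable.fun_sum fun i _ => (hc i).fun_mul (hsm i)),
      pd_sum _ fun i _ => (hc i).fun_mul (hsm i)]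
    funext x
    simp only [pd_mul (hc _) (hsm _), pd_coord, ih (ha.shift _), ha.shift_shift _ l,
      Finset.sum_add_distrib, sum_mul_taylorPart]
    have : (k : ℝ) + 2 ≠ 0 := by positivity
    simp
    field_simp
    ring

lemma pd_succ_taylorPart_zero (a : List (Fin d) → ℝ) (l : Fin d) :
    pd l.succ (taylorPart 0 a) = fun _ => 0 := pd_const _ _

end CauchySolutions

section CauchyDerivatives

variable {d : ℕ} {F : ℕ → ℝ → ℝ}

lemma pd_comp_coord {n : ℕ} {u : ℝ → ℝ} (hu : Differentiable ℝ u) (i j : Fin n) :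
    pd i (fun x : Euc n => u (x j)) = fun x => if i = j then deriv u (x j) else 0 := by
  funext x
  have h1 : HasFDerivAt (fun x : Euc n => x j) (EuclideanSpace.proj (𝕜 := ℝ) j) x :=
    (EuclideanSpace.proj (𝕜 := ℝ) j).hasFDerivAt
  have h2 := (hu (x j)).hasDerivAt.comp_hasFDerivAt x h1
  have h3 : fderiv ℝ (fun x : Euc n => u (x j)) x = _ := h2.fderiv
  simp only [pd]
  rw [h3]
  simp [eq_comm]

lemma contDiff_comp_coord {u : ℝ → ℝ} (hu : ContDiff ℝ (⊤ : ℕ∞) u) (i : Fin (d + 1)) :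
    ContDiff ℝ (⊤ : ℕ∞) (fun x : Euc (d + 1) => u (x i)) := hu.comp (contDiff_coord i)

lemma contDiff_cauchySol (hF : ∀ j, ContDiff ℝ (⊤ : ℕ∞) (F j)) (k : ℕ) :
    ∀ (j : ℕ) (a : List (Fin d) → ℝ), ContDiff ℝ (⊤ : ℕ∞) (cauchySol F j k a) := by
  induction k using Nat.twoStepInduction with
  | zero => exact fun j a => (contDiff_comp_coord (hF j) 0).mul (contDiff_taylorPart 0 a)
  | one => exact fun j a => (contDiff_comp_coord (hF j) 0).mul (contDiff_taylorPart 1 a)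
  | more k ih _ =>
    exact fun j a => ((contDiff_comp_coord (hF j) 0).mul (contDiff_taylorPart (k + 2) a)).add
      (ih (j + 1) (wordLap a))

lemma pd_zero_mul_taylorPart {u : ℝ → ℝ} (hu : ContDiff ℝ (⊤ : ℕ∞) u) (k : ℕ)
    (a : List (Fin d) → ℝ) :
    pd 0 (fun x : Euc (d + 1) => u (x 0) * taylorPart k a x)
      = fun x => deriv u (x 0) * taylorPart k a x := by
  rw [pd_mul (contDiff_comp_coord hu 0).diff_of_infty (contDiff_taylorPart k a).diff_of_infty,
    pd_zero_taylorPart, pd_comp_coord (hu.differentiable (by simp))]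
  simp

lemma pd_succ_mul_taylorPart {u : ℝ → ℝ} (hu : ContDiff ℝ (⊤ : ℕ∞) u) (k : ℕ)
    (a : List (Fin d) → ℝ) (l : Fin d) :
    pd l.succ (fun x : Euc (d + 1) => u (x 0) * taylorPart k a x)
      = fun x => u (x 0) * pd l.succ (taylorPart k a) x := by
  rw [pd_mul (contDiff_comp_coord hu 0).diff_of_infty (contDiff_taylorPart k a).diff_of_infty,
    pd_comp_coord (hu.differentiable (by simp))]
  simp [Fin.succ_ne_zero]

lemma pd_zero_cauchySol (hF : ∀ j, ContDiff ℝ (⊤ : ℕ∞) (F j)) (k : ℕ) :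
    ∀ (j : ℕ) (a : List (Fin d) → ℝ),
      pd 0 (cauchySol F j k a) = cauchySol (fun j => deriv (F j)) j k a := by
  induction k using Nat.twoStepInduction with
  | zero => exact fun j a => pd_zero_mul_taylorPart (hF j) 0 a
  | one => exact fun j a => pd_zero_mul_taylorPart (hF j) 1 a
  | more k ih _ =>
    intro j a
    refine (pd_add ((contDiff_comp_coord (hF j) 0).mul
      (contDiff_taylorPart (k + 2) a)).diff_of_infty
      (contDiff_cauchySol hF k (j + 1) (wordLap a)).diff_of_infty 0).trans ?_
    rw [ih, pd_zero_mul_taylorPart (hF j)]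
    rfl

lemma pd_succ_cauchySol_zero (hF : ∀ j, ContDiff ℝ (⊤ : ℕ∞) (F j)) (j : ℕ)
    (a : List (Fin d) → ℝ) (l : Fin d) : pd l.succ (cauchySol F j 0 a) = fun _ => 0 := by
  refine (pd_succ_mul_taylorPart (hF j) 0 a l).trans ?_
  simp [pd_succ_taylorPart_zero]

lemma pd_succ_cauchySol (hF : ∀ j, ContDiff ℝ (⊤ : ℕ∞) (F j)) (k : ℕ) :
    ∀ (j : ℕ) {a : List (Fin d) → ℝ}, PermInvariant a → ∀ l : Fin d,
      pd l.succ (cauchySol F j (k + 1) a) = cauchySol F j k (shift l a) := by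
  have hadd : ∀ (k j : ℕ) (a : List (Fin d) → ℝ) (l : Fin d),
      pd l.succ (cauchySol F j (k + 2) a)
        = fun x => pd l.succ (fun x : Euc (d + 1) => F j (x 0) * taylorPart (k + 2) a x) x
          + pd l.succ (cauchySol F (j + 1) k (wordLap a)) x := fun k j a l =>
    pd_add ((contDiff_comp_coord (hF j) 0).mul (contDiff_taylorPart (k + 2) a)).diff_of_infty
      (contDiff_cauchySol hF k (j + 1) (wordLap a)).diff_of_infty l.succ
  induction k using Nat.twoStepInduction with
  | zero =>
    intro j a ha l
    refine (pd_succ_mul_taylorPart (hF j) 1 a l).trans ?_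
    rw [pd_succ_taylorPart 0 ha]
    rfl
  | one =>
    intro j a ha l
    rw [hadd, pd_succ_mul_taylorPart (hF j), pd_succ_taylorPart 1 ha, pd_succ_cauchySol_zero hF]
    funext x
    simp [cauchySol]
  | more k ih _ =>
    intro j a ha l
    rw [hadd, pd_succ_mul_taylorPart (hF j), pd_succ_taylorPart _ ha, ih _ ha.wordLap]
    funext x
    simp only [cauchySol]
    rw [ha.wordLap_shift]

/-- The relations between the coefficient functions that make `cauchySol F 0 k a` a solution of the
Helmholtz equation. -/
structure HelmholtzCoeff (F : ℕ → ℝ → ℝ) : Prop where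
  smooth : ∀ j, ContDiff ℝ (⊤ : ℕ∞) (F j)
  zero : ∀ s, deriv (deriv (F 0)) s = -F 0 s
  succ : ∀ j s, deriv (deriv (F (j + 1))) s = -F (j + 1) s - F j s

lemma helmholtzCoeff_cosCoeff : HelmholtzCoeff cosCoeff := by
  refine ⟨fun j => (contDiff_trigCoeff j).1, fun s => ?_, fun j s => ?_⟩
  · rw [deriv_cosCoeff]
    simp [sinCoeffPred, deriv_sinCoeff]
  · rw [deriv_cosCoeff]
    refine (((hasDerivAt_trigCoeff (j + 1) s).1.neg).sub
      (hasDerivAt_trigCoeff j s).1).deriv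

lemma helmholtzCoeff_sinCoeff : HelmholtzCoeff sinCoeff := by
  refine ⟨fun j => (contDiff_trigCoeff j).2, fun s => ?_, fun j s => ?_⟩
  · rw [deriv_sinCoeff, deriv_cosCoeff]
    simp [sinCoeffPred]
  · rw [deriv_sinCoeff, deriv_cosCoeff]
    simp [sinCoeffPred]

lemma contDiff_deriv_of_infty {u : ℝ → ℝ} (hu : ContDiff ℝ (⊤ : ℕ∞) u) :
    ContDiff ℝ (⊤ : ℕ∞) (deriv u) := (contDiff_infty_iff_deriv.1 hu).2

lemma HelmholtzCoeff.cauchySol_deriv_deriv_succ (hF : HelmholtzCoeff F) (k : ℕ) :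
    ∀ (j : ℕ) (a : List (Fin d) → ℝ) (x : Euc (d + 1)),
      cauchySol (fun j => deriv (deriv (F j))) (j + 1) k a x
        = -cauchySol F (j + 1) k a x - cauchySol F j k a x := by
  induction k using Nat.twoStepInduction with
  | zero =>
    intro j a x
    simp only [cauchySol, hF.succ]
    ring
  | one =>
    intro j a x
    simp only [cauchySol, hF.succ]
    ring
  | more k ih _ =>
    intro j a x
    simp only [cauchySol, hF.succ, ih]
    ring

lemma HelmholtzCoeff.helmholtz_cauchySol (hF : HelmholtzCoeff F) (k : ℕ)
    {a : List (Fin d) → ℝ} (ha : PermInvariant a) : Helmholtz (cauchySol F 0 k a) := by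
  refine ⟨contDiff_cauchySol hF.smooth k 0 a, fun x => ?_⟩
  rw [Fin.sum_univ_succ, pd_zero_cauchySol hF.smooth,
    pd_zero_cauchySol fun j => contDiff_deriv_of_infty (hF.smooth j)]
  match k with
  | 0 =>
    simp only [pd_succ_cauchySol_zero hF.smooth, pd_const]
    simp [cauchySol, hF.zero]
  | 1 =>
    simp only [pd_succ_cauchySol hF.smooth 0 0 ha, pd_succ_cauchySol_zero hF.smooth]
    simp [cauchySol, hF.zero]
  | k + 2 =>
    simp only [pd_succ_cauchySol hF.smooth (k + 1) 0 ha,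
      pd_succ_cauchySol hF.smooth k 0 (ha.shift _), sum_cauchySol_shift_shift]
    simp only [cauchySol, hF.zero, hF.cauchySol_deriv_deriv_succ]
    ring

lemma taylorPart_zero_point (k : ℕ) (a : List (Fin d) → ℝ) :
    taylorPart k a (0 : Euc (d + 1)) = if k = 0 then a [] else 0 := by
  cases k <;> simp [taylorPart]

lemma cauchySol_zero_point (h0 : ∀ j, F (j + 1) 0 = 0) (k : ℕ) (a : List (Fin d) → ℝ) :
    cauchySol F 0 k a 0 = if k = 0 then F 0 0 * a [] else 0 := by
  have h1 : ∀ (k j : ℕ) (a : List (Fin d) → ℝ), cauchySol F (j + 1) k a 0 = 0 := by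
    intro k
    induction k using Nat.twoStepInduction with
    | zero => intro j a; simp [cauchySol, h0]
    | one => intro j a; simp [cauchySol, h0]
    | more k ih _ => intro j a; simp [cauchySol, h0, ih]
  match k with
  | 0 => simp [cauchySol, taylorPart]
  | 1 => simp [cauchySol, taylorPart_zero_point]
  | k + 2 => simp [cauchySol, taylorPart_zero_point, h1]

lemma wordDeriv_zero_fun {n : ℕ} (w : List (Fin n)) :
    wordDeriv w (fun _ : Euc n => (0 : ℝ)) = fun _ => 0 := by
  induction w with
  | nil => rfl
  | cons i w ih => rw [wordDeriv_cons, ih, pd_const]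

lemma wordDeriv_concat {n : ℕ} (w : List (Fin n)) (i : Fin n) {g : Euc n → ℝ}
    (hg : ContDiff ℝ (⊤ : ℕ∞) g) : wordDeriv (i :: w) g = wordDeriv w (pd i g) := by
  rw [wordDeriv_perm hg (List.perm_append_singleton i w).symm, wordDeriv_append]
  rfl

lemma wordDeriv_cauchySol_zero (hF : ∀ j, ContDiff ℝ (⊤ : ℕ∞) (F j)) (h0 : ∀ j, F (j + 1) 0 = 0)
    (v : List (Fin d)) : ∀ (k : ℕ) {a : List (Fin d) → ℝ}, PermInvariant a →
      wordDeriv (v.map Fin.succ) (cauchySol F 0 k a) 0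
        = if v.length = k then F 0 0 * a v else 0 := by
  induction v with
  | nil =>
    intro k a _
    simp [cauchySol_zero_point h0, eq_comm]
  | cons l v ih =>
    intro k a ha
    rw [List.map_cons, wordDeriv_concat _ _ (contDiff_cauchySol hF k 0 a)]
    cases k with
    | zero => simp [pd_succ_cauchySol_zero hF, wordDeriv_zero_fun]
    | succ k =>
      rw [pd_succ_cauchySol hF k 0 ha, ih k (ha.shift l)]
      simp [shift]

end CauchyDerivatives

section CauchyBounds

variable {d : ℕ}

lemma abs_taylorPart_le {x : Euc (d + 1)} {ρ : ℝ} (hx : ∀ i, |x i| ≤ ρ) (k : ℕ) :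
    ∀ (a : List (Fin d) → ℝ) (A : ℝ), (∀ w, w.length = k → |a w| ≤ A) →
      |taylorPart k a x| ≤ A * ((d * ρ) ^ k / k.factorial) := by
  have hρ : 0 ≤ ρ := (abs_nonneg _).trans (hx 0)
  induction k with
  | zero => exact fun a A h => by simpa [taylorPart] using h [] rfl
  | succ k ih =>
    intro a A h
    have hk : 0 < (k : ℝ) + 1 := by positivity
    simp only [taylorPart]
    rw [abs_div, abs_of_pos hk, div_le_iff₀ hk]
    calc |∑ i : Fin d, x i.succ * taylorPart k (shift i a) x|
        ≤ ∑ i : Fin d, |x i.succ * taylorPart k (shift i a) x| := Finset.abs_sum_le_sum_abs _ _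
      _ ≤ ∑ _i : Fin d, ρ * (A * ((d * ρ) ^ k / k.factorial)) := by
          refine Finset.sum_le_sum fun i _ => ?_
          rw [abs_mul]
          exact mul_le_mul (hx _) (ih _ A fun w hw => h _ (by simp [hw])) (abs_nonneg _) hρ
      _ = A * ((d * ρ) ^ (k + 1) / (k + 1).factorial) * (k + 1) := by
          rw [Nat.factorial_succ]
          have : (k.factorial : ℝ) ≠ 0 := by positivity
          push_cast
          simp
          field_simp
          ring

lemma inv_factorial_mul_inv_factorial_le (p k : ℕ) :
    1 / (p.factorial : ℝ) * (1 / k.factorial) ≤ 2 ^ (p + k) / (p + k).factorial := by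
  have h1 : ((p + k).choose p * p.factorial * k.factorial : ℝ) = (p + k).factorial := by
    have h := Nat.add_choose_mul_factorial_mul_factorial p k
    rw [← Nat.choose_symm_add] at h
    exact_mod_cast h
  have h2 : ((p + k).choose p : ℝ) ≤ 2 ^ (p + k) := by exact_mod_cast Nat.choose_le_two_pow _ _
  rw [← mul_div_mul_comm, one_mul, div_le_div_iff₀ (by positivity) (by positivity), ← h1, one_mul,
    mul_assoc]
  exact mul_le_mul_of_nonneg_right h2 (by positivity)

lemma abs_cauchySol_le {F : ℕ → ℝ → ℝ} {e : ℕ}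
    (hF : ∀ j s, |F j s| ≤ |s| ^ (2 * j + e) / (2 * j + e).factorial)
    {x : Euc (d + 1)} {ρ c : ℝ} (hx : ∀ i, |x i| ≤ ρ) (hc : 1 ≤ c) (hdc : d ≤ c) (k : ℕ) :
    ∀ (j : ℕ) (a : List (Fin d) → ℝ) (A : ℝ), 0 ≤ A → (∀ w, w.length = k → |a w| ≤ A) →
      |cauchySol F j k a x| ≤ (k + 1) * (A * ((c * ρ) ^ k * ρ ^ (2 * j + e) *
        (2 ^ (2 * j + e + k) / (2 * j + e + k).factorial))) := by
  have hρ : 0 ≤ ρ := (abs_nonneg _).trans (hx 0)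
  have hterm : ∀ (k j : ℕ) (a : List (Fin d) → ℝ) (A : ℝ), (∀ w, w.length = k → |a w| ≤ A) →
      0 ≤ A → |F j (x 0) * taylorPart k a x| ≤ A * ((c * ρ) ^ k * ρ ^ (2 * j + e) *
        (2 ^ (2 * j + e + k) / (2 * j + e + k).factorial)) := by
    intro k j a A h hA
    rw [abs_mul]
    calc |F j (x 0)| * |taylorPart k a x|
        ≤ (ρ ^ (2 * j + e) / (2 * j + e).factorial) * (A * ((c * ρ) ^ k / k.factorial)) := by
          refine mul_le_mul ((hF _ _).trans ?_) ((abs_taylorPart_le hx k a A h).trans ?_)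
            (abs_nonneg _) (by positivity)
          · gcongr
            exact hx 0
          · gcongr
      _ = A * ((c * ρ) ^ k * ρ ^ (2 * j + e) *
            (1 / ((2 * j + e).factorial : ℝ) * (1 / k.factorial))) := by ring
      _ ≤ _ := by
          gcongr
          exact inv_factorial_mul_inv_factorial_le _ _
  induction k using Nat.twoStepInduction with
  | zero =>
    intro j a A hA h
    refine (hterm 0 j a A h hA).trans (le_of_eq ?_)
    push_cast
    ring
  | one =>
    intro j a A hA h
    refine (hterm 1 j a A h hA).trans ?_
    refine le_mul_of_one_le_left (by positivity) (by norm_num)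
  | more k ih _ =>
    intro j a A hA h
    have hlap : ∀ w, w.length = k → |wordLap a w| ≤ d * A := by
      intro w hw
      calc |wordLap a w| ≤ ∑ l, |a (l :: l :: w)| := Finset.abs_sum_le_sum_abs _ _
        _ ≤ ∑ _l : Fin d, A := Finset.sum_le_sum fun l _ => h _ (by simp [hw])
        _ = d * A := by simp
    have hdc2 : (d : ℝ) ≤ c ^ 2 := hdc.trans (by nlinarith)
    have h1 := hterm (k + 2) j a A h hA
    have h2 := ih (j + 1) (wordLap a) (d * A) (by positivity) hlap
    rw [show 2 * (j + 1) + e + k = 2 * j + e + (k + 2) by ring] at h2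
    simp only [cauchySol]
    refine (abs_add_le _ _).trans ((add_le_add h1 h2).trans ?_)
    set W : ℝ := 2 ^ (2 * j + e + (k + 2)) / ((2 * j + e + (k + 2)).factorial : ℝ) with hW
    have hW0 : 0 ≤ W := by positivity
    have h3 : d * A * ((c * ρ) ^ k * ρ ^ (2 * (j + 1) + e) * W)
        ≤ A * ((c * ρ) ^ (k + 2) * ρ ^ (2 * j + e) * W) := by
      calc d * A * ((c * ρ) ^ k * ρ ^ (2 * (j + 1) + e) * W)
          = d * (A * ((c * ρ) ^ k * ρ ^ (2 * (j + 1) + e) * W)) := by ring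
        _ ≤ c ^ 2 * (A * ((c * ρ) ^ k * ρ ^ (2 * (j + 1) + e) * W)) := by gcongr
        _ = _ := by ring
    have h4 : 0 ≤ A * ((c * ρ) ^ (k + 2) * ρ ^ (2 * j + e) * W) := by positivity
    have h5 := mul_le_mul_of_nonneg_left h3 (show (0 : ℝ) ≤ k + 1 by positivity)
    push_cast
    linarith

lemma succ_mul_two_pow_div_factorial_le (k : ℕ) :
    ((k : ℝ) + 1) * (2 ^ k / k.factorial) ≤ 4 ^ k / k.factorial := by
  rw [← mul_div_assoc]
  gcongr
  have h : (k : ℝ) + 1 ≤ 2 ^ k := by exact_mod_cast Nat.lt_two_pow_self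
  calc ((k : ℝ) + 1) * 2 ^ k ≤ 2 ^ k * 2 ^ k := by gcongr
    _ = 4 ^ k := by rw [← mul_pow]; norm_num

lemma abs_cauchySol_cosCoeff_le {x : Euc (d + 1)} {ρ c : ℝ} (hx : ∀ i, |x i| ≤ ρ) (hc : 1 ≤ c)
    (hdc : d ≤ c) {k : ℕ} {a : List (Fin d) → ℝ} {A : ℝ} (hA : 0 ≤ A)
    (h : ∀ w, w.length = k → |a w| ≤ A) :
    |cauchySol cosCoeff 0 k a x| ≤ A * ((4 * c * ρ) ^ k / k.factorial) := by
  have hρ : 0 ≤ ρ := (abs_nonneg _).trans (hx 0)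
  have h1 := abs_cauchySol_le (e := 0) (fun j s => (abs_trigCoeff_le j s).1) hx hc hdc k 0 a A hA h
  simp only [Nat.mul_zero, Nat.zero_add, pow_zero, mul_one] at h1
  refine h1.trans ?_
  calc (k + 1) * (A * ((c * ρ) ^ k * (2 ^ k / k.factorial)))
      = A * (c * ρ) ^ k * (((k : ℝ) + 1) * (2 ^ k / k.factorial)) := by ring
    _ ≤ A * (c * ρ) ^ k * (4 ^ k / k.factorial) := by
        gcongr
        exact succ_mul_two_pow_div_factorial_le k
    _ = _ := by rw [mul_assoc 4, mul_pow 4]; ring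

lemma abs_cauchySol_sinCoeff_le {x : Euc (d + 1)} {ρ c : ℝ} (hx : ∀ i, |x i| ≤ ρ) (hc : 1 ≤ c)
    (hdc : d ≤ c) {k : ℕ} {a : List (Fin d) → ℝ} {A : ℝ} (hA : 0 ≤ A)
    (h : ∀ w, w.length = k → |a w| ≤ A) :
    |cauchySol sinCoeff 0 k a x| ≤ 2 * ρ * A * ((4 * c * ρ) ^ k / k.factorial) := by
  have hρ : 0 ≤ ρ := (abs_nonneg _).trans (hx 0)
  have h1 := abs_cauchySol_le (e := 1) (fun j s => (abs_trigCoeff_le j s).2) hx hc hdc k 0 a A hA h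
  simp only [Nat.mul_zero, Nat.zero_add, pow_one, Nat.add_comm 1 k] at h1
  refine h1.trans ?_
  have hk : (k.factorial : ℝ) ≠ 0 := by positivity
  have h2 : (2 : ℝ) ^ k ≤ 4 ^ k := by gcongr; norm_num
  calc (k + 1) * (A * ((c * ρ) ^ k * ρ * (2 ^ (k + 1) / (k + 1).factorial)))
      = 2 * ρ * A * ((c * ρ) ^ k * 2 ^ k / k.factorial) := by
        rw [Nat.factorial_succ]
        push_cast
        field_simp
        ring
    _ ≤ 2 * ρ * A * ((c * ρ) ^ k * 4 ^ k / k.factorial) := by gcongr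
    _ = _ := by rw [mul_assoc 4, mul_pow 4]; ring

end CauchyBounds

section Rotation

variable {d : ℕ}

/-- The derivative of `g` along the infinitesimal rotation in the plane of the coordinates `0` and
`i.succ`. -/
def rotGen (i : Fin d) (g : Euc (d + 1) → ℝ) (x : Euc (d + 1)) : ℝ :=
  x i.succ * pd 0 g x - x 0 * pd i.succ g x

lemma sum_mul_cauchySol_cosCoeff (k : ℕ) : ∀ (j : ℕ) {a : List (Fin d) → ℝ}, PermInvariant a →
    ∀ x : Euc (d + 1),
      ∑ i, x i.succ * cauchySol cosCoeff j (k + 1) (shift i a) x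
          - x 0 * cauchySol sinCoeff j k (wordLap a) x
        = (k + 2 + 2 * j) * cauchySol cosCoeff j (k + 2) a x
          - 2 * j * cosCoeff j (x 0) * taylorPart (k + 2) a x := by
  have hT : ∀ (k : ℕ) (s : ℝ) (a : List (Fin d) → ℝ) (x : Euc (d + 1)),
      ∑ i, x i.succ * (s * taylorPart k (shift i a) x) = s * ((k + 1) * taylorPart (k + 1) a x) := by
    intro k s a x
    rw [← sum_mul_taylorPart, Finset.mul_sum]
    exact Finset.sum_congr rfl fun i _ => by ring
  induction k using Nat.twoStepInduction with
  | zero =>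
    intro j a ha x
    simp only [cauchySol, hT]
    push_cast
    linear_combination -taylorPart 0 (wordLap a) x * cosCoeff_succ j (x 0)
  | one =>
    intro j a ha x
    simp only [cauchySol, mul_add, Finset.sum_add_distrib, hT, ha.wordLap_shift]
    push_cast
    linear_combination -taylorPart 1 (wordLap a) x * cosCoeff_succ j (x 0)
  | more k ih _ =>
    intro j a ha x
    have h := ih (j + 1) ha.wordLap x
    have e1 : ∀ i, cauchySol cosCoeff j (k + 2 + 1) (shift i a) x
        = cosCoeff j (x 0) * taylorPart (k + 3) (shift i a) x
          + cauchySol cosCoeff (j + 1) (k + 1) (shift i (wordLap a)) x := by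
      intro i
      rw [← ha.wordLap_shift]
      rfl
    have e2 : cauchySol cosCoeff j (k + 2 + 2) a x = cosCoeff j (x 0) * taylorPart (k + 4) a x
        + cauchySol cosCoeff (j + 1) (k + 2) (wordLap a) x := rfl
    have e3 : cauchySol sinCoeff j (k + 2) (wordLap a) x
        = sinCoeff j (x 0) * taylorPart (k + 2) (wordLap a) x
          + cauchySol sinCoeff (j + 1) k (wordLap (wordLap a)) x := rfl
    simp only [e1, e2, e3, mul_add, Finset.sum_add_distrib, hT]
    push_cast at h ⊢
    linear_combination h - taylorPart (k + 2) (wordLap a) x * cosCoeff_succ j (x 0)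

lemma sum_mul_cauchySol_deriv_cosCoeff (k : ℕ) : ∀ (j : ℕ) {a : List (Fin d) → ℝ},
    PermInvariant a → ∀ x : Euc (d + 1),
      ∑ i, x i.succ * cauchySol (fun j => deriv (cosCoeff j)) j (k + 1) (shift i a) x
          - x 0 * cauchySol cosCoeff j k (wordLap a) x
        = -(k + 2 + 2 * j) * cauchySol sinCoeff j (k + 2) a x
          + 2 * j * sinCoeff j (x 0) * taylorPart (k + 2) a x
          - (k + 1 + 2 * j) * cauchySol sinCoeff j k (wordLap a) x
          - (k + 2) * sinCoeffPred j (x 0) * taylorPart (k + 2) a x := by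
  have hT : ∀ (k : ℕ) (s : ℝ) (a : List (Fin d) → ℝ) (x : Euc (d + 1)),
      ∑ i, x i.succ * (s * taylorPart k (shift i a) x) = s * ((k + 1) * taylorPart (k + 1) a x) := by
    intro k s a x
    rw [← sum_mul_taylorPart, Finset.mul_sum]
    exact Finset.sum_congr rfl fun i _ => by ring
  induction k using Nat.twoStepInduction with
  | zero =>
    intro j a ha x
    simp only [cauchySol, hT, deriv_cosCoeff]
    push_cast
    linear_combination taylorPart 0 (wordLap a) x * sinCoeff_succ j (x 0)
  | one =>
    intro j a ha x
    simp only [cauchySol, mul_add, Finset.sum_add_distrib, hT, ha.wordLap_shift, deriv_cosCoeff]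
    simp only [sinCoeffPred]
    push_cast
    linear_combination taylorPart 1 (wordLap a) x * sinCoeff_succ j (x 0)
  | more k ih _ =>
    intro j a ha x
    have h := ih (j + 1) ha.wordLap x
    have e1 : ∀ i, cauchySol (fun j => deriv (cosCoeff j)) j (k + 2 + 1) (shift i a) x
        = (-sinCoeff j (x 0) - sinCoeffPred j (x 0)) * taylorPart (k + 3) (shift i a) x
          + cauchySol (fun j => deriv (cosCoeff j)) (j + 1) (k + 1) (shift i (wordLap a)) x := by
      intro i
      rw [← ha.wordLap_shift, ← congrFun (deriv_cosCoeff j) (x 0)]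
      rfl
    have e2 : cauchySol sinCoeff j (k + 2 + 2) a x = sinCoeff j (x 0) * taylorPart (k + 4) a x
        + cauchySol sinCoeff (j + 1) (k + 2) (wordLap a) x := rfl
    have e3 : cauchySol cosCoeff j (k + 2) (wordLap a) x
        = cosCoeff j (x 0) * taylorPart (k + 2) (wordLap a) x
          + cauchySol cosCoeff (j + 1) k (wordLap (wordLap a)) x := rfl
    have e4 : cauchySol sinCoeff j (k + 2) (wordLap a) x
        = sinCoeff j (x 0) * taylorPart (k + 2) (wordLap a) x
          + cauchySol sinCoeff (j + 1) k (wordLap (wordLap a)) x := rfl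
    simp only [e1, e2, e3, e4, mul_add, Finset.sum_add_distrib, hT]
    simp only [sinCoeffPred] at h
    push_cast at h ⊢
    linear_combination h + taylorPart (k + 2) (wordLap a) x * sinCoeff_succ j (x 0)

lemma sum_rotGen_cauchySol_sinCoeff (k : ℕ) {a : List (Fin d) → ℝ} (ha : PermInvariant a)
    (x : Euc (d + 1)) :
    ∑ i, rotGen i (cauchySol sinCoeff 0 k (shift i a)) x
      = (k + 1) * cauchySol cosCoeff 0 (k + 1) a x := by
  have hs : ∀ j, ContDiff ℝ (⊤ : ℕ∞) (sinCoeff j) := fun j => (contDiff_trigCoeff j).2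
  simp only [rotGen, pd_zero_cauchySol hs, deriv_sinCoeff]
  cases k with
  | zero =>
    simp only [pd_succ_cauchySol_zero hs]
    simp [cauchySol, taylorPart, Finset.mul_sum, mul_left_comm]
  | succ k =>
    simp only [pd_succ_cauchySol hs k 0 (ha.shift _), Finset.sum_sub_distrib, ← Finset.mul_sum,
      sum_cauchySol_shift_shift]
    have h := sum_mul_cauchySol_cosCoeff k 0 ha x
    push_cast at h ⊢
    linear_combination h

lemma sum_rotGen_cauchySol_cosCoeff_zero (a : List (Fin d) → ℝ) (x : Euc (d + 1)) :
    ∑ i, rotGen i (cauchySol cosCoeff 0 0 (shift i a)) x = -cauchySol sinCoeff 0 1 a x := by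
  have hs : ∀ j, ContDiff ℝ (⊤ : ℕ∞) (cosCoeff j) := fun j => (contDiff_trigCoeff j).1
  simp only [rotGen, pd_zero_cauchySol hs, pd_succ_cauchySol_zero hs]
  simp [cauchySol, taylorPart, Finset.mul_sum, mul_left_comm, deriv_cosCoeff, sinCoeffPred]

lemma sum_rotGen_cauchySol_cosCoeff (k : ℕ) {a : List (Fin d) → ℝ} (ha : PermInvariant a)
    (x : Euc (d + 1)) :
    ∑ i, rotGen i (cauchySol cosCoeff 0 (k + 1) (shift i a)) x
      = -(k + 2) * cauchySol sinCoeff 0 (k + 2) a x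
        - (k + 1) * cauchySol sinCoeff 0 k (wordLap a) x := by
  have hs : ∀ j, ContDiff ℝ (⊤ : ℕ∞) (cosCoeff j) := fun j => (contDiff_trigCoeff j).1
  simp only [rotGen, pd_zero_cauchySol hs, pd_succ_cauchySol hs k 0 (ha.shift _),
    Finset.sum_sub_distrib, ← Finset.mul_sum, sum_cauchySol_shift_shift]
  have h := sum_mul_cauchySol_deriv_cosCoeff k 0 ha x
  simp only [sinCoeffPred] at h
  push_cast at h ⊢
  linear_combination h

end Rotation

section TrigonometricPolynomials

variable {n : ℕ}

/-- Trigonometric polynomials with frequencies on the unit sphere. -/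
def IsTrigPoly (h : Euc n → ℝ) : Prop :=
  ∃ (N : ℕ) (ξ : Fin N → Metric.sphere (0 : Euc n) 1) (α β : Fin N → ℝ),
    h = fun y => ∑ j, (α j * Real.cos ⟪y, (ξ j : Euc n)⟫ + β j * Real.sin ⟪y, (ξ j : Euc n)⟫)

lemma isTrigPoly_zero : IsTrigPoly (fun _ : Euc n => (0 : ℝ)) :=
  ⟨0, Fin.elim0, Fin.elim0, Fin.elim0, by simp⟩

lemma isTrigPoly_wave (ξ : Metric.sphere (0 : Euc n) 1) (α β : ℝ) :
    IsTrigPoly (fun y => α * Real.cos ⟪y, (ξ : Euc n)⟫ + β * Real.sin ⟪y, (ξ : Euc n)⟫) :=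
  ⟨1, fun _ => ξ, fun _ => α, fun _ => β, by simp⟩

lemma IsTrigPoly.add {g h : Euc n → ℝ} (hg : IsTrigPoly g) (hh : IsTrigPoly h) :
    IsTrigPoly (fun x => g x + h x) := by
  obtain ⟨N, ξ, α, β, rfl⟩ := hg
  obtain ⟨N', ξ', α', β', rfl⟩ := hh
  refine ⟨N + N', Fin.append ξ ξ', Fin.append α α', Fin.append β β', ?_⟩
  funext y
  simp [Fin.sum_univ_add]

lemma IsTrigPoly.const_mul {g : Euc n → ℝ} (hg : IsTrigPoly g) (c : ℝ) :
    IsTrigPoly (fun x => c * g x) := by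
  obtain ⟨N, ξ, α, β, rfl⟩ := hg
  refine ⟨N, ξ, fun j => c * α j, fun j => c * β j, ?_⟩
  funext y
  simp [Finset.mul_sum, mul_add, mul_assoc]

lemma pd_comp_inner {u : ℝ → ℝ} (hu : Differentiable ℝ u) (ξ : Euc n) (i : Fin n) :
    pd i (fun y : Euc n => u ⟪y, ξ⟫) = fun y => ξ i * deriv u ⟪y, ξ⟫ := by
  funext x
  have h1 : HasFDerivAt (fun y : Euc n => ⟪y, ξ⟫) ((innerSL ℝ : Euc n →L[ℝ] _) ξ) x := by
    have := ((innerSL ℝ : Euc n →L[ℝ] _) ξ).hasFDerivAt (x := x)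
    refine this.congr_of_eventuallyEq (Filter.Eventually.of_forall fun y => ?_)
    exact real_inner_comm _ _
  have h2 : fderiv ℝ (fun y : Euc n => u ⟪y, ξ⟫) x = _ :=
    ((hu _).hasDerivAt.comp_hasFDerivAt x h1).fderiv
  simp only [pd]
  rw [h2]
  simp [EuclideanSpace.inner_single_right, mul_comm]

lemma helmholtz_wave (ξ : Metric.sphere (0 : Euc n) 1) (α β : ℝ) :
    Helmholtz (fun y => α * Real.cos ⟪y, (ξ : Euc n)⟫ + β * Real.sin ⟪y, (ξ : Euc n)⟫) := by
  have hξ : ∑ i, (ξ : Euc n) i ^ 2 = 1 := by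
    rw [← EuclideanSpace.real_norm_sq_eq, norm_eq_of_mem_sphere ξ, one_pow]
  set u : ℝ → ℝ := fun s => α * Real.cos s + β * Real.sin s with hu
  have hus : ContDiff ℝ (⊤ : ℕ∞) u :=
    (contDiff_const.mul Real.contDiff_cos).add (contDiff_const.mul Real.contDiff_sin)
  have hu1 : deriv u = fun s => -α * Real.sin s + β * Real.cos s := by
    funext s
    exact ((((Real.hasDerivAt_cos s).const_mul α).add ((Real.hasDerivAt_sin s).const_mul β)).congr_deriv
      (by ring)).deriv
  have hu2 : deriv (deriv u) = fun s => -u s := by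
    rw [hu1]
    funext s
    exact ((((Real.hasDerivAt_sin s).const_mul (-α)).add
      ((Real.hasDerivAt_cos s).const_mul β)).congr_deriv (by simp only [hu]; ring)).deriv
  have hus1 : ContDiff ℝ (⊤ : ℕ∞) (deriv u) := (contDiff_infty_iff_deriv.1 hus).2
  have hin : ContDiff ℝ (⊤ : ℕ∞) (fun y : Euc n => ⟪y, (ξ : Euc n)⟫) :=
    contDiff_id.inner ℝ contDiff_const
  have hcd : Differentiable ℝ (fun y : Euc n => deriv u ⟪y, (ξ : Euc n)⟫) :=
    (hus1.comp hin).diff_of_infty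
  change Helmholtz (fun y => u ⟪y, (ξ : Euc n)⟫)
  refine ⟨hus.comp hin, fun x => ?_⟩
  simp only [pd_comp_inner (hus.differentiable (by simp))]
  simp only [pd_const_mul hcd, pd_comp_inner (hus1.differentiable (by simp)), hu2]
  have hsum : ∑ i, (ξ : Euc n) i * ((ξ : Euc n) i * -u ⟪x, (ξ : Euc n)⟫)
      = (∑ i, (ξ : Euc n) i ^ 2) * -u ⟪x, (ξ : Euc n)⟫ := by
    rw [Finset.sum_mul]
    exact Finset.sum_congr rfl fun i _ => by ring
  rw [hsum, hξ]
  ring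

lemma IsTrigPoly.helmholtz {g : Euc n → ℝ} (hg : IsTrigPoly g) : Helmholtz g := by
  obtain ⟨N, ξ, α, β, rfl⟩ := hg
  exact Helmholtz.sum _ fun j _ => helmholtz_wave (ξ j) (α j) (β j)

/-- Functions that are locally uniform limits of trigonometric polynomials with frequencies on the
unit sphere. -/
def Approximable (g : Euc n → ℝ) : Prop :=
  ∀ R ε : ℝ, 0 < ε → ∃ h, IsTrigPoly h ∧ ∀ x, ‖x‖ ≤ R → |g x - h x| < ε

lemma IsTrigPoly.approximable {g : Euc n → ℝ} (hg : IsTrigPoly g) : Approximable g :=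
  fun _ _ hε => ⟨g, hg, fun x _ => by simpa using hε⟩

lemma approximable_of_limit {g : Euc n → ℝ}
    (h : ∀ R ε : ℝ, 0 < ε → ∃ h, Approximable h ∧ ∀ x, ‖x‖ ≤ R → |g x - h x| < ε) :
    Approximable g := by
  intro R ε hε
  obtain ⟨u, hu, hgu⟩ := h R (ε / 2) (half_pos hε)
  obtain ⟨v, hv, huv⟩ := hu R (ε / 2) (half_pos hε)
  refine ⟨v, hv, fun x hx => ?_⟩
  have := abs_sub_le (g x) (u x) (v x)
  linarith [hgu x hx, huv x hx]

lemma Approximable.add {g h : Euc n → ℝ} (hg : Approximable g) (hh : Approximable h) :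
    Approximable (fun x => g x + h x) := by
  intro R ε hε
  obtain ⟨u, hu, hgu⟩ := hg R (ε / 2) (half_pos hε)
  obtain ⟨v, hv, hhv⟩ := hh R (ε / 2) (half_pos hε)
  refine ⟨_, hu.add hv, fun x hx => ?_⟩
  rw [add_sub_add_comm]
  have := abs_add_le (g x - u x) (h x - v x)
  linarith [hgu x hx, hhv x hx]

lemma Approximable.const_mul {g : Euc n → ℝ} (hg : Approximable g) (c : ℝ) :
    Approximable (fun x => c * g x) := by
  intro R ε hε
  have hc : 0 < |c| + 1 := by positivity
  obtain ⟨u, hu, hgu⟩ := hg R (ε / (|c| + 1)) (by positivity)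
  refine ⟨_, hu.const_mul c, fun x hx => ?_⟩
  rw [← mul_sub, abs_mul]
  have h1 := hgu x hx
  rw [lt_div_iff₀ hc] at h1
  nlinarith [abs_nonneg (g x - u x)]

lemma Approximable.sum {ι : Type*} (s : Finset ι) {G : ι → Euc n → ℝ}
    (hG : ∀ k ∈ s, Approximable (G k)) : Approximable (fun x => ∑ k ∈ s, G k x) := by
  classical
  induction s using Finset.induction_on with
  | empty => simpa using isTrigPoly_zero.approximable
  | insert a s ha ih =>
    simp only [Finset.sum_insert ha]
    exact (hG a (by simp)).add (ih fun k hk => hG k (by simp [hk]))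

end TrigonometricPolynomials

section Rotations

variable {d : ℕ}

/-- The rotation by the angle `θ` in the plane of the coordinates `0` and `i.succ`. -/
def rot (i : Fin d) (θ : ℝ) (x : Euc (d + 1)) : Euc (d + 1) :=
  x + (Real.cos θ * x 0 + Real.sin θ * x i.succ - x 0) • EuclideanSpace.single 0 1
    + (Real.cos θ * x i.succ - Real.sin θ * x 0 - x i.succ) • EuclideanSpace.single i.succ 1

lemma rot_apply_zero (i : Fin d) (θ : ℝ) (x : Euc (d + 1)) :
    rot i θ x 0 = Real.cos θ * x 0 + Real.sin θ * x i.succ := by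
  simp [rot, (Fin.succ_ne_zero i).symm]

lemma rot_apply_succ (i : Fin d) (θ : ℝ) (x : Euc (d + 1)) :
    rot i θ x i.succ = Real.cos θ * x i.succ - Real.sin θ * x 0 := by
  simp [rot, Fin.succ_ne_zero]

lemma inner_rot (i : Fin d) (θ : ℝ) (x y : Euc (d + 1)) :
    ⟪rot i θ x, y⟫ = ⟪x, rot i (-θ) y⟫ := by
  simp only [rot, inner_add_left, inner_add_right, real_inner_smul_left, real_inner_smul_right,
    EuclideanSpace.inner_single_left, EuclideanSpace.inner_single_right, Real.cos_neg, Real.sin_neg]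
  simp
  ring

lemma norm_rot (i : Fin d) (θ : ℝ) (x : Euc (d + 1)) : ‖rot i θ x‖ = ‖x‖ := by
  have h : ‖rot i θ x‖ ^ 2 = ‖x‖ ^ 2 := by
    rw [← real_inner_self_eq_norm_sq, ← real_inner_self_eq_norm_sq, inner_rot]
    rw [real_inner_comm]
    nth_rw 1 [rot]
    rw [rot_apply_zero, rot_apply_succ]
    nth_rw 1 [rot]
    simp only [inner_add_left, real_inner_smul_left, EuclideanSpace.inner_single_left,
      Real.cos_neg, Real.sin_neg]
    simp
    linear_combination (x 0 ^ 2 + x i.succ ^ 2) * Real.sin_sq_add_cos_sq θ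
  exact (sq_eq_sq₀ (norm_nonneg _) (norm_nonneg _)).1 h

lemma rot_zero (i : Fin d) (x : Euc (d + 1)) : rot i 0 x = x := by simp [rot]

lemma continuous_rot (i : Fin d) : Continuous (fun p : ℝ × Euc (d + 1) => rot i p.1 p.2) := by
  have h : ∀ j : Fin (d + 1), Continuous (fun x : Euc (d + 1) => x j) := fun j =>
    (EuclideanSpace.proj (𝕜 := ℝ) j).continuous
  have h0 := (h 0).comp (continuous_snd (X := ℝ))
  have h1 := (h i.succ).comp (continuous_snd (X := ℝ))
  have hc := Real.continuous_cos.comp (continuous_fst (X := ℝ) (Y := Euc (d + 1)))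
  have hs := Real.continuous_sin.comp (continuous_fst (X := ℝ) (Y := Euc (d + 1)))
  exact (continuous_snd.add ((((hc.mul h0).add (hs.mul h1)).sub h0).smul continuous_const)).add
    ((((hc.mul h1).sub (hs.mul h0)).sub h1).smul continuous_const)

lemma hasDerivAt_comp_rot {g : Euc (d + 1) → ℝ} (hg : Differentiable ℝ g) (i : Fin d)
    (x : Euc (d + 1)) (θ : ℝ) :
    HasDerivAt (fun θ => g (rot i θ x)) (rotGen i g (rot i θ x)) θ := by
  have h0 : HasDerivAt (fun θ => Real.cos θ * x 0 + Real.sin θ * x i.succ - x 0)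
      (rot i θ x i.succ) θ := by
    refine ((((Real.hasDerivAt_cos θ).mul_const (x 0)).add
      ((Real.hasDerivAt_sin θ).mul_const (x i.succ))).sub_const (x 0)).congr_deriv ?_
    rw [rot_apply_succ]
    ring
  have h1 : HasDerivAt (fun θ => Real.cos θ * x i.succ - Real.sin θ * x 0 - x i.succ)
      (-rot i θ x 0) θ := by
    refine ((((Real.hasDerivAt_cos θ).mul_const (x i.succ)).sub
      ((Real.hasDerivAt_sin θ).mul_const (x 0))).sub_const (x i.succ)).congr_deriv ?_
    rw [rot_apply_zero]
    ring
  have h2 : HasDerivAt (fun θ => rot i θ x)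
      (rot i θ x i.succ • EuclideanSpace.single 0 1
        + (-rot i θ x 0) • EuclideanSpace.single i.succ 1) θ :=
    ((h0.smul_const _).const_add x).add (h1.smul_const _)
  refine ((hg _).hasFDerivAt.comp_hasDerivAt θ h2).congr_deriv ?_
  simp [rotGen, pd]
  ring

lemma Approximable.comp_rot {g : Euc (d + 1) → ℝ} (hg : Approximable g) (i : Fin d) (θ : ℝ) :
    Approximable (fun x => g (rot i θ x)) := by
  intro R ε hε
  obtain ⟨u, ⟨N, ξ, α, β, rfl⟩, hgu⟩ := hg R ε hε
  refine ⟨_, ⟨N, fun j => ⟨rot i (-θ) (ξ j), ?_⟩, α, β, rfl⟩, fun x hx => ?_⟩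
  · rw [mem_sphere_zero_iff_norm, norm_rot, norm_eq_of_mem_sphere]
  · have := hgu (rot i θ x) (by rwa [norm_rot])
    simpa only [inner_rot] using this

lemma Approximable.rotGen {g : Euc (d + 1) → ℝ} (hg : Approximable g)
    (hs : ContDiff ℝ (⊤ : ℕ∞) g) (i : Fin d) : Approximable (rotGen i g) := by
  refine approximable_of_limit fun R ε hε => ?_
  have hcont : Continuous (_root_.rotGen i g) :=
    ((contDiff_coord i.succ).mul (hs.pd 0)).continuous.sub
      ((contDiff_coord 0).mul (hs.pd i.succ)).continuous
  have hK : IsCompact (Set.Icc (0 : ℝ) 1 ×ˢ Metric.closedBall (0 : Euc (d + 1)) R) :=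
    isCompact_Icc.prod (isCompact_closedBall 0 R)
  have huc := hK.uniformContinuousOn_of_continuous
    ((hcont.comp (continuous_rot i)).continuousOn)
  obtain ⟨δ, hδ, H⟩ := Metric.uniformContinuousOn_iff.1 huc ε hε
  obtain ⟨θ, hθ0, hθ⟩ : ∃ θ : ℝ, 0 < θ ∧ θ < min δ 1 := exists_between (lt_min hδ one_pos)
  refine ⟨fun x => θ⁻¹ * (g (rot i θ x) + (-1) * g x),
    ((hg.comp_rot i θ).add (hg.const_mul (-1))).const_mul _, fun x hx => ?_⟩
  obtain ⟨c, hc, hc'⟩ := exists_hasDerivAt_eq_slope (fun θ => g (rot i θ x))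
    (fun θ => _root_.rotGen i g (rot i θ x)) hθ0
    (fun s _ => (hasDerivAt_comp_rot hs.diff_of_infty i x s).continuousAt.continuousWithinAt)
    (fun s _ => hasDerivAt_comp_rot hs.diff_of_infty i x s)
  have hval : θ⁻¹ * (g (rot i θ x) + (-1) * g x) = _root_.rotGen i g (rot i c x) := by
    rw [hc', rot_zero, sub_zero, div_eq_inv_mul]
    ring
  have hxB : x ∈ Metric.closedBall (0 : Euc (d + 1)) R := by simpa using hx
  have h := H (0, x) ⟨by simp, hxB⟩ (c, x)
    ⟨⟨hc.1.le, (hc.2.trans (hθ.trans_le (min_le_right _ _))).le⟩, hxB⟩ (by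
      rw [Prod.dist_eq]
      simp only [dist_self, Real.dist_eq, zero_sub, abs_neg, abs_of_pos hc.1]
      exact max_lt (hc.2.trans (hθ.trans_le (min_le_left _ _))) hδ)
  simp only [hval]
  simpa [Real.dist_eq, rot_zero] using h

lemma approximable_cauchySol (k : ℕ) : ∀ {a : List (Fin d) → ℝ}, PermInvariant a →
    Approximable (cauchySol cosCoeff 0 k a) ∧ Approximable (cauchySol sinCoeff 0 k a) := by
  have hC : ∀ (k : ℕ) (a : List (Fin d) → ℝ),
      ContDiff ℝ (⊤ : ℕ∞) (cauchySol cosCoeff 0 k a) := fun k =>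
    contDiff_cauchySol (fun j => (contDiff_trigCoeff j).1) k 0
  have hS : ∀ (k : ℕ) (a : List (Fin d) → ℝ),
      ContDiff ℝ (⊤ : ℕ∞) (cauchySol sinCoeff 0 k a) := fun k =>
    contDiff_cauchySol (fun j => (contDiff_trigCoeff j).2) k 0
  have hstep : ∀ k, (∀ {a : List (Fin d) → ℝ}, PermInvariant a →
      Approximable (cauchySol sinCoeff 0 k a)) → ∀ {a : List (Fin d) → ℝ}, PermInvariant a →
      Approximable (cauchySol cosCoeff 0 (k + 1) a) := by
    intro k h a ha
    have : cauchySol cosCoeff 0 (k + 1) a = fun x => ((k : ℝ) + 1)⁻¹ *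
        ∑ i, rotGen i (cauchySol sinCoeff 0 k (shift i a)) x := by
      funext x
      have : (k : ℝ) + 1 ≠ 0 := by positivity
      rw [sum_rotGen_cauchySol_sinCoeff k ha]
      field_simp
    rw [this]
    exact (Approximable.sum _ fun i _ => (h (ha.shift i)).rotGen (hS _ _) i).const_mul _
  have hcos0 : ∀ a : List (Fin d) → ℝ, Approximable (cauchySol cosCoeff 0 0 a) ∧
      Approximable (cauchySol sinCoeff 0 0 a) := by
    intro a
    let ξ : Metric.sphere (0 : Euc (d + 1)) 1 := ⟨EuclideanSpace.single 0 1, by simp⟩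
    have h1 := (isTrigPoly_wave ξ (a []) 0).approximable
    have h2 := (isTrigPoly_wave ξ 0 (a [])).approximable
    constructor
    · convert h1 using 2 with x
      simp [ξ, cauchySol, cosCoeff, trigCoeff, taylorPart, EuclideanSpace.inner_single_right, mul_comm]
    · convert h2 using 2 with x
      simp [ξ, cauchySol, sinCoeff, trigCoeff, taylorPart, EuclideanSpace.inner_single_right, mul_comm]
  induction k using Nat.twoStepInduction with
  | zero => exact fun _ => hcos0 _
  | one =>
    intro a ha
    refine ⟨hstep 0 (fun _ => (hcos0 _).2) ha, ?_⟩
    have : cauchySol sinCoeff 0 1 a = fun x => (-1) *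
        ∑ i, rotGen i (cauchySol cosCoeff 0 0 (shift i a)) x := by
      funext x
      rw [sum_rotGen_cauchySol_cosCoeff_zero]
      ring
    rw [this]
    exact (Approximable.sum _ fun i _ => (hcos0 _).1.rotGen (hC _ _) i).const_mul _
  | more k ih0 ih1 =>
    intro a ha
    refine ⟨hstep (k + 1) (fun h => (ih1 h).2) ha, ?_⟩
    have : cauchySol sinCoeff 0 (k + 2) a = fun x => (-((k : ℝ) + 2)⁻¹) *
        (∑ i, rotGen i (cauchySol cosCoeff 0 (k + 1) (shift i a)) x
          + (k + 1) * cauchySol sinCoeff 0 k (wordLap a) x) := by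
      funext x
      have : (k : ℝ) + 2 ≠ 0 := by positivity
      rw [sum_rotGen_cauchySol_cosCoeff k ha]
      field_simp
      ring
    rw [this]
    exact ((Approximable.sum _ fun i _ => (ih1 (ha.shift i)).1.rotGen (hC _ _) i).add
      ((ih0 ha.wordLap).2.const_mul _)).const_mul _

end Rotations

section Density

variable {d : ℕ}

lemma exists_perm_map_succ_append_replicate (w : List (Fin (d + 1))) :
    ∃ (v : List (Fin d)) (q : ℕ), w.Perm (v.map Fin.succ ++ List.replicate q 0) := by
  induction w with
  | nil => exact ⟨[], 0, by simp⟩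
  | cons i w ih =>
    obtain ⟨v, q, h⟩ := ih
    refine Fin.cases ?_ (fun l => ?_) i
    · exact ⟨v, q + 1, (h.cons 0).trans List.perm_middle.symm⟩
    · exact ⟨l :: v, q, h.cons l.succ⟩

lemma Helmholtz.wordDeriv_eq_zero {g : Euc (d + 1) → ℝ} (hg : Helmholtz g) {m : ℕ}
    (h0 : ∀ v : List (Fin d), v.length ≤ m → _root_.wordDeriv (v.map Fin.succ) g 0 = 0)
    (h1 : ∀ v : List (Fin d), v.length ≤ m →
      _root_.wordDeriv (v.map Fin.succ) (_root_.pd 0 g) 0 = 0)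
    {w : List (Fin (d + 1))} (hw : w.length ≤ m) : _root_.wordDeriv w g 0 = 0 := by
  have key : ∀ (q : ℕ) (v : List (Fin d)), v.length + q ≤ m →
      _root_.wordDeriv (v.map Fin.succ ++ List.replicate q 0) g 0 = 0 := by
    intro q
    induction q using Nat.twoStepInduction with
    | zero => exact fun v hv => by simpa using h0 v hv
    | one =>
      intro v hv
      rw [wordDeriv_append]
      exact h1 v (by omega)
    | more q ih _ =>
      intro v hv
      set w := v.map Fin.succ ++ List.replicate q (0 : Fin (d + 1)) with hw
      have hsm := fun i => (hg.smooth.pd i).pd i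
      have e1 : v.map Fin.succ ++ List.replicate (q + 2) 0 = w ++ [0, 0] := by
        rw [hw, List.replicate_add, ← List.append_assoc]
        rfl
      have e2 : _root_.wordDeriv [0, 0] g
          = fun x => (fun _ => 0) x
            - (g x + ∑ l : Fin d, _root_.pd l.succ (_root_.pd l.succ g) x) := by
        funext x
        have := hg.eq x
        rw [Fin.sum_univ_succ] at this
        simp only [wordDeriv_cons, wordDeriv_nil]
        linarith
      rw [e1, wordDeriv_append, e2, wordDeriv_sub contDiff_const
        (hg.smooth.add (ContDiff.sum fun l _ => hsm _)), wordDeriv_add hg.smooth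
        (ContDiff.sum fun l _ => hsm _), wordDeriv_sum _ fun l _ => hsm _, wordDeriv_zero_fun]
      have e3 : ∀ l : Fin d, _root_.wordDeriv w (_root_.pd l.succ (_root_.pd l.succ g)) 0 = 0 := by
        intro l
        have : _root_.wordDeriv w (_root_.pd l.succ (_root_.pd l.succ g))
            = _root_.wordDeriv ((l :: l :: v).map Fin.succ ++ List.replicate q 0) g := by
          rw [show _root_.pd l.succ (_root_.pd l.succ g) = _root_.wordDeriv [l.succ, l.succ] g from rfl,
            ← wordDeriv_append]
          exact wordDeriv_perm hg.smooth List.perm_append_comm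
        rw [this]
        exact ih _ (by simp only [List.length_cons]; omega)
      have e4 : _root_.wordDeriv w g 0 = 0 := ih v (by omega)
      simp [e3, e4]
  obtain ⟨v, q, h⟩ := exists_perm_map_succ_append_replicate w
  rw [wordDeriv_perm hg.smooth h]
  refine key q v ?_
  have := h.length_eq
  simp at this
  omega

lemma pow_self_le_exp_pow_mul_factorial (k : ℕ) :
    (k : ℝ) ^ k ≤ Real.exp 1 ^ k * k.factorial := by
  have h := Real.pow_div_factorial_le_exp (k : ℝ) (by positivity) k
  rw [div_le_iff₀ (by positivity)] at h
  rwa [← Real.exp_nat_mul, mul_one]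

lemma Helmholtz.exists_abs_wordDeriv_le {n : ℕ} (hn : 0 < n) {g : Euc n → ℝ} (hg : Helmholtz g)
    {τ : ℝ} (hτ : 0 < τ) : ∃ M, 0 ≤ M ∧ ∀ w : List (Fin n),
      |_root_.wordDeriv w g 0| ≤ M * (w.length.factorial * τ ^ w.length) := by
  obtain ⟨C, hC1, hC⟩ := exists_gradient_bound n hn
  have hC' : GradientBound n C := hC
  have he := Real.exp_pos 1
  have hCp : 0 < C := by linarith
  set R : ℝ := C * Real.exp 1 / τ with hR
  have hRp : 0 < R := by positivity
  obtain ⟨M, hM⟩ := (isCompact_closedBall (0 : Euc n) R).exists_bound_of_continuousOn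
    hg.smooth.continuous.continuousOn
  have hM0 : 0 ≤ M := (norm_nonneg _).trans (hM 0 (by simp [hRp.le]))
  have hlarge : ∀ w : List (Fin n), R ≤ w.length →
      |_root_.wordDeriv w g 0| ≤ M * (w.length.factorial * τ ^ w.length) := by
    intro w hw
    have hk : (0 : ℝ) < w.length := hRp.trans_le hw
    have h := abs_wordDeriv_le hC' hg (r := R / w.length) (M := M) (by positivity)
      ((div_le_one hk).2 hw) w 0 (by
        intro y hy
        rw [mul_div_cancel₀ _ hk.ne'] at hy
        exact hM y (by simpa using hy))
    refine h.trans ?_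
    have e1 : C / (R / w.length) = w.length * (τ / Real.exp 1) := by
      rw [hR]
      field_simp
    rw [e1, mul_comm]
    refine mul_le_mul_of_nonneg_left ?_ hM0
    rw [mul_pow]
    refine (mul_le_mul_of_nonneg_right (pow_self_le_exp_pow_mul_factorial _)
      (by positivity)).trans (le_of_eq ?_)
    rw [div_pow]
    field_simp
  obtain ⟨M', hM'⟩ := ((List.finite_length_lt (Fin n) (⌈R⌉₊)).image fun w =>
    |_root_.wordDeriv w g 0| / (w.length.factorial * τ ^ w.length)).bddAbove
  refine ⟨max M M', hM0.trans (le_max_left _ _), fun w => ?_⟩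
  rcases le_or_gt R w.length with hw | hw
  · exact (hlarge w hw).trans (mul_le_mul_of_nonneg_right (le_max_left _ _) (by positivity))
  · have h := hM' ⟨w, Nat.lt_ceil.2 hw, rfl⟩
    simp only at h
    rw [div_le_iff₀ (by positivity)] at h
    exact h.trans (mul_le_mul_of_nonneg_right (le_max_right _ _) (by positivity))

lemma Helmholtz.abs_le_of_vanishing_jet {n : ℕ} (hn : 0 < n) {C : ℝ} (hC : GradientBound n C)
    (hC0 : 0 < C) {R S : ℝ} (hR : 0 < R) {g : Euc n → ℝ} (hg : Helmholtz g)
    (hS : ∀ x, ‖x‖ ≤ R + 2 * n * R * C * Real.exp 1 → |g x| ≤ S) {m : ℕ}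
    (hm : 2 * n * R * C * Real.exp 1 ≤ m + 1)
    (h0 : ∀ w : List (Fin n), w.length ≤ m → _root_.wordDeriv w g 0 = 0) {x : Euc n}
    (hx : ‖x‖ ≤ R) : |g x| ≤ S * (1 / 2) ^ (m + 1) := by
  have he := Real.exp_pos 1
  have hn' : (0 : ℝ) < n := by exact_mod_cast hn
  set ρ : ℝ := 2 * n * R * C * Real.exp 1 with hρ
  have hρ0 : 0 < ρ := by positivity
  have hS0 : 0 ≤ S := (abs_nonneg _).trans (hS x (by linarith))
  have hm1 : (0 : ℝ) < m + 1 := by positivity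
  have hB : ∀ w : List (Fin n), w.length = m + 1 → ∀ x, ‖x‖ ≤ R →
      |_root_.wordDeriv w g x| ≤ (C / (ρ / (m + 1))) ^ (m + 1) * S := by
    intro w hw x hx
    have h := abs_wordDeriv_le hC hg (r := ρ / (m + 1)) (M := S) (by positivity)
      ((div_le_one hm1).2 hm) w x (by
        intro y hy
        rw [hw] at hy
        push_cast at hy
        rw [mul_div_cancel₀ _ hm1.ne'] at hy
        refine hS y ?_
        have := norm_add_le (y - x) x
        rw [sub_add_cancel] at this
        linarith)
    rwa [hw] at h
  refine (_root_.abs_le_of_vanishing_jet hg.smooth h0 hB hx).trans ?_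
  have hk := pow_self_le_exp_pow_mul_factorial (m + 1)
  push_cast at hk
  have e1 : C / (ρ / (m + 1)) = (m + 1) * (1 / (2 * n * R * Real.exp 1)) := by
    rw [hρ]
    field_simp
  rw [e1]
  calc ((m + 1) * (1 / (2 * n * R * Real.exp 1))) ^ (m + 1) * S
        * ((n * ‖x‖) ^ (m + 1) / (m + 1).factorial)
      ≤ ((m + 1) * (1 / (2 * n * R * Real.exp 1))) ^ (m + 1) * S
        * ((n * R) ^ (m + 1) / (m + 1).factorial) := by gcongr
    _ = S * (((m : ℝ) + 1) ^ (m + 1) * ((n * R / (2 * n * R * Real.exp 1)) ^ (m + 1)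
          / (m + 1).factorial)) := by
        rw [mul_pow, div_pow, div_pow, one_pow]
        ring
    _ ≤ S * ((Real.exp 1 ^ (m + 1) * (m + 1).factorial)
          * ((n * R / (2 * n * R * Real.exp 1)) ^ (m + 1) / (m + 1).factorial)) := by gcongr
    _ = S * (Real.exp 1 * (n * R / (2 * n * R * Real.exp 1))) ^ (m + 1) := by
        rw [mul_pow (Real.exp 1)]
        have : ((m + 1).factorial : ℝ) ≠ 0 := by positivity
        field_simp
    _ = S * (1 / 2) ^ (m + 1) := by
        congr 2
        field_simp

/-- The partial sum of degree `m` of the expansion of a Helmholtz solution with Cauchy data given by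
the families `a` and `b`. -/
def cauchySum (a b : List (Fin d) → ℝ) (m : ℕ) (x : Euc (d + 1)) : ℝ :=
  ∑ k ∈ Finset.range (m + 1), (cauchySol cosCoeff 0 k a x + cauchySol sinCoeff 0 k b x)

lemma wordDeriv_cauchySum {a b : List (Fin d) → ℝ} (m : ℕ) (w : List (Fin (d + 1))) :
    wordDeriv w (cauchySum a b m) = fun x => ∑ k ∈ Finset.range (m + 1),
      (wordDeriv w (cauchySol cosCoeff 0 k a) x + wordDeriv w (cauchySol sinCoeff 0 k b) x) := by
  have hC : ∀ k, ContDiff ℝ (⊤ : ℕ∞) (cauchySol cosCoeff 0 k a) := fun k =>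
    contDiff_cauchySol (fun j => (contDiff_trigCoeff j).1) k 0 a
  have hS : ∀ k, ContDiff ℝ (⊤ : ℕ∞) (cauchySol sinCoeff 0 k b) := fun k =>
    contDiff_cauchySol (fun j => (contDiff_trigCoeff j).2) k 0 b
  have h := wordDeriv_sum (Finset.range (m + 1))
    (G := fun k x => cauchySol cosCoeff 0 k a x + cauchySol sinCoeff 0 k b x)
    (fun k _ => (hC k).add (hS k)) w
  refine h.trans ?_
  funext x
  exact Finset.sum_congr rfl fun k _ => congrFun (wordDeriv_add (hC k) (hS k) w) x

lemma wordDeriv_cauchySum_zero {a b : List (Fin d) → ℝ} (ha : PermInvariant a)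
    (hb : PermInvariant b) {m : ℕ} {v : List (Fin d)} (hv : v.length ≤ m) :
    wordDeriv (v.map Fin.succ) (cauchySum a b m) 0 = a v ∧
    wordDeriv (v.map Fin.succ) (pd 0 (cauchySum a b m)) 0 = b v := by
  have hC : ∀ j, ContDiff ℝ (⊤ : ℕ∞) (cosCoeff j) := fun j => (contDiff_trigCoeff j).1
  have hS : ∀ j, ContDiff ℝ (⊤ : ℕ∞) (sinCoeff j) := fun j => (contDiff_trigCoeff j).2
  have hS0 : ∀ j, sinCoeff j 0 = 0 := fun j => (trigCoeff_zero j).1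
  have hC0 : ∀ j, cosCoeff (j + 1) 0 = 0 := fun j => (trigCoeff_zero j).2
  have hC00 : cosCoeff 0 0 = 1 := by simp [cosCoeff, trigCoeff]
  have hmem : v.length ∈ Finset.range (m + 1) := by simpa [Nat.lt_succ_iff] using hv
  constructor
  · rw [wordDeriv_cauchySum]
    simp only [wordDeriv_cauchySol_zero hC hC0 v _ ha,
      wordDeriv_cauchySol_zero hS (fun j => hS0 _) v _ hb, hC00, hS0]
    simp [hv]
  · have e1 : ∀ g : Euc (d + 1) → ℝ, wordDeriv (v.map Fin.succ) (pd 0 g)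
        = wordDeriv (v.map Fin.succ ++ [0]) g := fun g => (wordDeriv_append _ [0] g).symm
    have hCd : ∀ j, deriv (cosCoeff j) 0 = 0 := by
      intro j
      rw [deriv_cosCoeff]
      cases j <;> simp [sinCoeffPred, hS0]
    rw [e1, wordDeriv_cauchySum]
    simp only [← e1, pd_zero_cauchySol hC, pd_zero_cauchySol hS,
      wordDeriv_cauchySol_zero (fun j => contDiff_deriv_of_infty (hC j)) (fun j => hCd _) v _ ha,
      deriv_sinCoeff, wordDeriv_cauchySol_zero hC hC0 v _ hb, hC00, hCd]
    simp [hv]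

lemma Helmholtz.exists_abs_cauchySum_le {f g : Euc (d + 1) → ℝ} (hf : Helmholtz f)
    (hg : Helmholtz g) {ρ : ℝ} (hρ : 0 < ρ) : ∃ S, ∀ m x, ‖x‖ ≤ ρ →
      |cauchySum (fun v => _root_.wordDeriv (v.map Fin.succ) f 0)
        (fun v => _root_.wordDeriv (v.map Fin.succ) g 0) m x| ≤ S := by
  have hc : (0 : ℝ) < d + 1 := by positivity
  have hτ : (0 : ℝ) < 1 / (8 * (d + 1) * ρ) := by positivity
  obtain ⟨A, hA, hfA⟩ := hf.exists_abs_wordDeriv_le d.succ_pos hτ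
  obtain ⟨B, hB, hgB⟩ := hg.exists_abs_wordDeriv_le d.succ_pos hτ
  refine ⟨(A + 2 * ρ * B) * 2, fun m x hx => ?_⟩
  have hxi : ∀ i, |x i| ≤ ρ := fun i => (PiLp.norm_apply_le x i).trans hx
  have hfac : ∀ k : ℕ, (k.factorial : ℝ) * (1 / (8 * (d + 1) * ρ)) ^ k
      * ((4 * (d + 1) * ρ) ^ k / k.factorial) = (1 / 2) ^ k := by
    intro k
    have hk : (k.factorial : ℝ) ≠ 0 := by positivity
    calc (k.factorial : ℝ) * (1 / (8 * (d + 1) * ρ)) ^ k * ((4 * (d + 1) * ρ) ^ k / k.factorial)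
        = (1 / (8 * (d + 1) * ρ)) ^ k * (4 * (d + 1) * ρ) ^ k := by field_simp
      _ = (1 / 2) ^ k := by
          rw [← mul_pow]
          congr 1
          field_simp
          norm_num
  have hcos : ∀ k, |cauchySol cosCoeff 0 k (fun v => _root_.wordDeriv (v.map Fin.succ) f 0) x|
      ≤ A * (1 / 2) ^ k := by
    intro k
    refine (abs_cauchySol_cosCoeff_le hxi (c := d + 1) (by simp) (by simp)
      (A := A * (k.factorial * (1 / (8 * (d + 1) * ρ)) ^ k)) (by positivity) ?_).trans
      (le_of_eq ?_)
    · intro w hw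
      simpa [hw] using hfA (w.map Fin.succ)
    · rw [mul_assoc, hfac]
  have hsin : ∀ k, |cauchySol sinCoeff 0 k (fun v => _root_.wordDeriv (v.map Fin.succ) g 0) x|
      ≤ 2 * ρ * B * (1 / 2) ^ k := by
    intro k
    refine (abs_cauchySol_sinCoeff_le hxi (c := d + 1) (by simp) (by simp)
      (A := B * (k.factorial * (1 / (8 * (d + 1) * ρ)) ^ k)) (by positivity) ?_).trans
      (le_of_eq ?_)
    · intro w hw
      simpa [hw] using hgB (w.map Fin.succ)
    · rw [← mul_assoc (2 * ρ), mul_assoc (2 * ρ * B), hfac]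
  calc _ ≤ ∑ k ∈ Finset.range (m + 1), (A + 2 * ρ * B) * (1 / 2 : ℝ) ^ k := by
        refine (Finset.abs_sum_le_sum_abs _ _).trans (Finset.sum_le_sum fun k _ => ?_)
        refine (abs_add_le _ _).trans ?_
        linarith [hcos k, hsin k]
    _ ≤ (A + 2 * ρ * B) * 2 := by
        rw [← Finset.mul_sum]
        exact mul_le_mul_of_nonneg_left (sum_geometric_two_le _) (by positivity)

lemma Helmholtz.approximable {f : Euc (d + 1) → ℝ} (hf : Helmholtz f) : Approximable f := by
  refine approximable_of_limit fun R₀ ε hε => ?_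
  obtain ⟨C, hC1, hC⟩ := exists_gradient_bound (d + 1) d.succ_pos
  have hC' : GradientBound (d + 1) C := hC
  have hC0 : 0 < C := by linarith
  set R : ℝ := max R₀ 1 with hR
  have hR0 : 0 < R := one_pos.trans_le (le_max_right _ _)
  set L : ℝ := 2 * (d + 1 : ℕ) * R * C * Real.exp 1 with hL
  have hL0 : 0 < L := by positivity
  set a : List (Fin d) → ℝ := fun v => _root_.wordDeriv (v.map Fin.succ) f 0
  set b : List (Fin d) → ℝ := fun v => _root_.wordDeriv (v.map Fin.succ) (_root_.pd 0 f) 0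
  have ha : PermInvariant a := fun v w h => congrFun (wordDeriv_perm hf.smooth (h.map _)) 0
  have hb : PermInvariant b := fun v w h => congrFun (wordDeriv_perm (hf.pd 0).smooth (h.map _)) 0
  obtain ⟨S, hS⟩ := hf.exists_abs_cauchySum_le (hf.pd 0) (ρ := R + L) (by positivity)
  obtain ⟨M, hM⟩ := (isCompact_closedBall (0 : Euc (d + 1)) (R + L)).exists_bound_of_continuousOn
    hf.smooth.continuous.continuousOn
  have hlim : Filter.Tendsto (fun m : ℕ => (M + S) * (1 / 2 : ℝ) ^ (m + 1)) Filter.atTop (nhds 0) := by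
    have h := (tendsto_pow_atTop_nhds_zero_of_lt_one (r := (1 / 2 : ℝ)) (by norm_num)
      (by norm_num)).comp (Filter.tendsto_add_atTop_nat 1)
    simpa using h.const_mul (M + S)
  obtain ⟨m, hm1, hm2⟩ := ((hlim.eventually (gt_mem_nhds hε)).and
    (Filter.eventually_ge_atTop ⌈L⌉₊)).exists
  have hmL : L ≤ m + 1 := by
    have := Nat.ceil_le.1 hm2
    linarith
  have hsum : Helmholtz (cauchySum a b m) := Helmholtz.sum _ fun k _ =>
    (helmholtzCoeff_cosCoeff.helmholtz_cauchySol k ha).add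
      (helmholtzCoeff_sinCoeff.helmholtz_cauchySol k hb)
  have hr : Helmholtz (fun x => f x - cauchySum a b m x) := hf.sub hsum
  refine ⟨cauchySum a b m, Approximable.sum _ fun k _ =>
    (approximable_cauchySol k ha).1.add (approximable_cauchySol k hb).2, fun x hx => ?_⟩
  refine (hr.abs_le_of_vanishing_jet d.succ_pos hC' hC0 hR0 (S := M + S) ?_ hmL ?_
    (hx.trans (le_max_left _ _))).trans_lt hm1
  · intro y hy
    have h1 : |f y| ≤ M := hM y (mem_closedBall_zero_iff.2 hy)
    exact (abs_sub _ _).trans (add_le_add h1 (hS m y hy))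
  · intro w hw
    refine hr.wordDeriv_eq_zero (m := m) (fun v hv => ?_) (fun v hv => ?_) hw
    · rw [wordDeriv_sub hf.smooth hsum.smooth]
      exact sub_eq_zero.2 (wordDeriv_cauchySum_zero ha hb hv).1.symm
    · rw [pd_sub hf.differentiable hsum.differentiable,
        wordDeriv_sub (hf.pd 0).smooth (hsum.pd 0).smooth]
      exact sub_eq_zero.2 (wordDeriv_cauchySum_zero ha hb hv).2.symm

end Density

theorem stmt9 (n : ℕ) (hn : 2 ≤ n)
    (f : EuclideanSpace ℝ (Fin n) → ℝ) (hf : ContDiff ℝ (⊤ : ℕ∞) f)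
    (hfeq : ∀ x : EuclideanSpace ℝ (Fin n), laplacian f x + f x = 0)
    (K : Set (EuclideanSpace ℝ (Fin n))) (hK : IsCompact K)
    (t : ℕ) (ε : ℝ) (hε : 0 < ε) :
    ∃ (N : ℕ) (ξ : Fin N → Metric.sphere (0 : EuclideanSpace ℝ (Fin n)) 1)
      (α β : Fin N → ℝ),
      ∀ m : ℕ, m ≤ t → ∀ x ∈ K,
        ‖iteratedFDeriv ℝ m
            (fun y => f y - ∑ j, (α j * Real.cos ⟪y, (ξ j : EuclideanSpace ℝ (Fin n))⟫
              + β j * Real.sin ⟪y, (ξ j : EuclideanSpace ℝ (Fin n))⟫)) x‖ < ε := by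
  obtain ⟨d, rfl⟩ : ∃ d, n = d + 1 := ⟨n - 1, by omega⟩
  have hfH : Helmholtz f := ⟨hf, hfeq⟩
  obtain ⟨C, hC1, hC⟩ := exists_gradient_bound (d + 1) d.succ_pos
  have hnC : 1 ≤ ((d + 1 : ℕ) : ℝ) * C :=
    one_le_mul_of_one_le_of_one_le (by exact_mod_cast Nat.succ_pos d) hC1
  have hpos : 0 < (((d + 1 : ℕ) : ℝ) * C) ^ t := pow_pos (one_pos.trans_le hnC) t
  obtain ⟨R, hR⟩ := hK.isBounded.exists_norm_le
  obtain ⟨h, hh, hfh⟩ := hfH.approximable (R + t) (ε / (2 * (((d + 1 : ℕ) : ℝ) * C) ^ t))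
    (by positivity)
  have hr := hfH.sub hh.helmholtz
  obtain ⟨N, ξ, α, β, rfl⟩ := hh
  refine ⟨N, ξ, α, β, fun m hm x hx => ?_⟩
  have hmt : (m : ℝ) ≤ t := by exact_mod_cast hm
  refine (norm_iteratedFDeriv_le_of_helmholtz hC m _ hr x
    (ε / (2 * (((d + 1 : ℕ) : ℝ) * C) ^ t)) fun y hy => (hfh y ?_).le).trans_lt ?_
  · have h1 := norm_add_le (y - x) x
    rw [sub_add_cancel] at h1
    linarith [hR x hx]
  · calc (((d + 1 : ℕ) : ℝ) * C) ^ m * (ε / (2 * (((d + 1 : ℕ) : ℝ) * C) ^ t))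
        ≤ (((d + 1 : ℕ) : ℝ) * C) ^ t * (ε / (2 * (((d + 1 : ℕ) : ℝ) * C) ^ t)) := by
          gcongr
      _ = ε / 2 := by field_simp
      _ < ε := half_lt_self hε
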